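/- Let M ≥ 2 and let r₁ < r₂ < ... < r_M be real numbers satisfying j_{0,1} < r₁ < √2 · j_{0,1}, j_{0,2} < r_M < j_{0,3}, and r_k² − r_{k−1}² < j_{0,1}² for every 2 ≤ k ≤ M. Let F : ℝ² → ℝ be a smooth function with ΔF + F = 0, F(0) ≠ 0, 0 a regular value of F, and F(x) ≠ 0 for every x with |x| = r_k for some k. Then there exists a connected component U of {x ∈ ℝ² : F(x) ≠ 0} contained in the open ball {|x| < r_M} such that ℝ² \ U has exactly two connected components (that is, F has a nodal domain of connectivity 1 contained in the ball of radius r_M around the origin). -/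

import Mathlib

open Metric intervalIntegral

/-- The Bessel function of the first kind of integer order `n`:
`J_n(s) = (1/π) ∫₀^π cos (n θ - s sin θ) dθ`. -/
noncomputable def besselJ (n : ℕ) (s : ℝ) : ℝ :=
  (1 / Real.pi) * ∫ θ in (0:ℝ)..Real.pi, Real.cos (n * θ - s * Real.sin θ)

/-- `besselJZero n k` is the `k`-th smallest positive zero of `J_n` (with the
convention `besselJZero n 0 = 0`). -/
noncomputable def besselJZero (n : ℕ) : ℕ → ℝ
  | 0 => 0
  | k + 1 => sInf {r : ℝ | besselJZero n k < r ∧ besselJ n r = 0}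

/-- The Euclidean Laplacian of a function on the plane. -/
noncomputable def laplacian (f : EuclideanSpace ℝ (Fin 2) → ℝ)
    (x : EuclideanSpace ℝ (Fin 2)) : ℝ :=
  ∑ i : Fin 2, fderiv ℝ (fun y => fderiv ℝ f y (EuclideanSpace.single i 1)) x
    (EuclideanSpace.single i 1)

/-- The set of connected components of a set `s`. -/
def componentsOf (s : Set (EuclideanSpace ℝ (Fin 2))) :
    Set (Set (EuclideanSpace ℝ (Fin 2))) :=
  {C | ∃ y ∈ s, C = connectedComponentIn s y}

abbrev E2 := EuclideanSpace ℝ (Fin 2)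

/-- Polar parametrization. -/
noncomputable def pol (r θ : ℝ) : E2 := !₂[r * Real.cos θ, r * Real.sin θ]

noncomputable def dx (F : E2 → ℝ) (x : E2) : ℝ := fderiv ℝ F x (EuclideanSpace.single 0 1)
noncomputable def dy (F : E2 → ℝ) (x : E2) : ℝ := fderiv ℝ F x (EuclideanSpace.single 1 1)

lemma continuous_pol : Continuous (fun p : ℝ × ℝ => pol p.1 p.2) := by
  unfold pol
  refine (PiLp.continuous_toLp 2 _).comp ?_
  refine continuous_pi ?_
  intro i
  fin_cases i <;> simp <;> fun_prop

lemma fderiv_vec (F : E2 → ℝ) (x : E2) (a b : ℝ) :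
    fderiv ℝ F x !₂[a, b] = a * dx F x + b * dy F x := by
  have : (!₂[a, b] : E2) = a • EuclideanSpace.single 0 1 + b • EuclideanSpace.single 1 1 := by
    ext i; fin_cases i <;> simp
  rw [this, map_add, map_smul, map_smul]; rfl

lemma hasDerivAt_pol_r (r θ : ℝ) :
    HasDerivAt (fun r => pol r θ) (!₂[Real.cos θ, Real.sin θ] : E2) r := by
  have h : (fun r => pol r θ) = fun r : ℝ => r • (!₂[Real.cos θ, Real.sin θ] : E2) := by
    funext r; ext i; fin_cases i <;> simp [pol]
  rw [h]
  simpa using (hasDerivAt_id r).smul_const (!₂[Real.cos θ, Real.sin θ] : E2)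

lemma hasDerivAt_pol_t (r θ : ℝ) :
    HasDerivAt (fun θ => pol r θ) (!₂[- (r * Real.sin θ), r * Real.cos θ] : E2) θ := by
  have h : (fun θ => pol r θ) = fun θ : ℝ => (r * Real.cos θ) • (EuclideanSpace.single 0 1 : E2)
      + (r * Real.sin θ) • (EuclideanSpace.single 1 1 : E2) := by
    funext r; ext i; fin_cases i <;> simp [pol]
  rw [h]
  have h2 : (!₂[- (r * Real.sin θ), r * Real.cos θ] : E2) =
     (r * (-Real.sin θ)) • (EuclideanSpace.single 0 1 : E2)
      + (r * Real.cos θ) • (EuclideanSpace.single 1 1 : E2) := by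
    ext i; fin_cases i <;> simp
  rw [h2]
  exact (((Real.hasDerivAt_cos θ).const_mul r).smul_const _).add
    (((Real.hasDerivAt_sin θ).const_mul r).smul_const _)

lemma hasDerivAt_comp_r {F : E2 → ℝ} (hF : Differentiable ℝ F) (r θ : ℝ) :
    HasDerivAt (fun r => F (pol r θ))
      (Real.cos θ * dx F (pol r θ) + Real.sin θ * dy F (pol r θ)) r := by
  rw [← fderiv_vec]
  exact (hF _).hasFDerivAt.comp_hasDerivAt r (hasDerivAt_pol_r r θ)

lemma hasDerivAt_comp_t {F : E2 → ℝ} (hF : Differentiable ℝ F) (r θ : ℝ) :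
    HasDerivAt (fun θ => F (pol r θ))
      (r * (- Real.sin θ * dx F (pol r θ) + Real.cos θ * dy F (pol r θ))) θ := by
  have : r * (- Real.sin θ * dx F (pol r θ) + Real.cos θ * dy F (pol r θ)) =
    fderiv ℝ F (pol r θ) !₂[- (r * Real.sin θ), r * Real.cos θ] := by
    rw [fderiv_vec]; ring
  rw [this]
  exact (hF _).hasFDerivAt.comp_hasDerivAt θ (hasDerivAt_pol_t r θ)

lemma pol_norm (r θ : ℝ) : ‖pol r θ‖ = |r| := by
  rw [EuclideanSpace.norm_eq, ← Real.sqrt_sq_eq_abs]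
  congr 1
  simp [pol, mul_pow, ← mul_add]

lemma hasDerivAt_param (f f' : ℝ → ℝ → ℝ) (hf : ∀ r θ, HasDerivAt (fun r => f r θ) (f' r θ) r)
    (hc : Continuous (fun p : ℝ × ℝ => f p.1 p.2)) (hc' : Continuous (fun p : ℝ × ℝ => f' p.1 p.2))
    (a b r : ℝ) :
    HasDerivAt (fun r => ∫ θ in a..b, f r θ) (∫ θ in a..b, f' r θ) r := by
  have hK : IsCompact (Set.Icc (r-1) (r+1) ×ˢ Set.uIcc a b) := isCompact_Icc.prod isCompact_uIcc
  obtain ⟨C, hC⟩ := hK.exists_bound_of_continuousOn hc'.continuousOn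
  refine (intervalIntegral.hasDerivAt_integral_of_dominated_loc_of_deriv_le
    (F := f) (F' := f') (s := Set.Icc (r-1) (r+1)) (bound := fun _ => C)
    (Icc_mem_nhds (by linarith) (by linarith)) ?_ ?_ ?_ ?_ ?_ ?_).2
  · refine Filter.Eventually.of_forall fun x => ?_
    have : Continuous (f x) := hc.comp (by fun_prop : Continuous fun θ : ℝ => (x, θ))
    exact this.aestronglyMeasurable
  · have : Continuous (f r) := hc.comp (by fun_prop : Continuous fun θ : ℝ => (r, θ))
    exact this.intervalIntegrable _ _
  · have : Continuous (f' r) := hc'.comp (by fun_prop : Continuous fun θ : ℝ => (r, θ))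
    exact this.aestronglyMeasurable
  · refine Filter.Eventually.of_forall fun t ht x hx => ?_
    exact hC (x, t) ⟨hx, Set.uIoc_subset_uIcc ht⟩
  · exact intervalIntegrable_const
  · exact Filter.Eventually.of_forall fun t ht x hx => hf x t

lemma contDiff_dx {F : E2 → ℝ} (hF : ContDiff ℝ (⊤ : ℕ∞) F) : ContDiff ℝ (⊤ : ℕ∞) (dx F) := by
  unfold dx
  exact (hF.fderiv_right (m := (⊤ : ℕ∞)) (by simp)).clm_apply contDiff_const
lemma contDiff_dy {F : E2 → ℝ} (hF : ContDiff ℝ (⊤ : ℕ∞) F) : ContDiff ℝ (⊤ : ℕ∞) (dy F) := by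
  unfold dy
  exact (hF.fderiv_right (m := (⊤ : ℕ∞)) (by simp)).clm_apply contDiff_const

lemma laplacian_eq (F : E2 → ℝ) (x : E2) : laplacian F x = dx (dx F) x + dy (dy F) x := by
  simp only [laplacian, Fin.sum_univ_two]; rfl

/-- Bessel equation of order zero. -/
def BesselODE (g : ℝ → ℝ) : Prop :=
  ∃ g1 g2 : ℝ → ℝ, (∀ r, HasDerivAt g (g1 r) r) ∧ (∀ r, HasDerivAt g1 (g2 r) r) ∧
    ∀ r, r * g2 r + g1 r + r * g r = 0

noncomputable def mean (F : E2 → ℝ) (r : ℝ) : ℝ := ∫ θ in (-Real.pi)..Real.pi, F (pol r θ)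

lemma mean_ode {F : E2 → ℝ} (hF : ContDiff ℝ (⊤ : ℕ∞) F) (hE : ∀ x, laplacian F x + F x = 0) :
    BesselODE (mean F) := by
  have hne : ((⊤ : ℕ∞) : WithTop ℕ∞) ≠ 0 := by simp
  have hx := contDiff_dx hF
  have hy := contDiff_dy hF
  have hxx := contDiff_dx hx
  have hyy := contDiff_dy hy
  have hxy := contDiff_dx hy
  have hyx := contDiff_dy hx
  have cP := continuous_pol
  have cF := hF.continuous.comp cP
  have cx := hx.continuous.comp cP
  have cy := hy.continuous.comp cP
  have cxx := hxx.continuous.comp cP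
  have cxy := hxy.continuous.comp cP
  have cyx := hyx.continuous.comp cP
  have cyy := hyy.continuous.comp cP
  simp only [Function.comp_def] at cF cx cy cxx cxy cyx cyy
  let f1 : ℝ → ℝ → ℝ := fun r θ => Real.cos θ * dx F (pol r θ) + Real.sin θ * dy F (pol r θ)
  let f2 : ℝ → ℝ → ℝ := fun r θ => Real.cos θ * (Real.cos θ * dx (dx F) (pol r θ) + Real.sin θ * dy (dx F) (pol r θ)) + Real.sin θ * (Real.cos θ * dx (dy F) (pol r θ) + Real.sin θ * dy (dy F) (pol r θ))
  have c1 : Continuous (fun p : ℝ × ℝ => f1 p.1 p.2) := by simp only [f1]; fun_prop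
  have c2 : Continuous (fun p : ℝ × ℝ => f2 p.1 p.2) := by simp only [f2]; fun_prop
  refine ⟨fun r => ∫ θ in (-Real.pi)..Real.pi, f1 r θ, fun r => ∫ θ in (-Real.pi)..Real.pi, f2 r θ, ?_, ?_, ?_⟩
  · intro r
    exact hasDerivAt_param (fun r θ => F (pol r θ)) f1
      (fun r θ => hasDerivAt_comp_r (hF.differentiable hne) r θ) cF c1 _ _ r
  · intro r
    exact hasDerivAt_param f1 f2
      (fun r θ => ((hasDerivAt_comp_r (hx.differentiable hne) r θ).const_mul _).add
        ((hasDerivAt_comp_r (hy.differentiable hne) r θ).const_mul _)) c1 c2 _ _ r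
  · intro r
    have slice : ∀ {f : ℝ × ℝ → ℝ}, Continuous f → IntervalIntegrable (fun θ => f (r, θ)) MeasureTheory.volume (-Real.pi) Real.pi := by
      intro f hf
      exact (hf.comp (by fun_prop : Continuous fun θ : ℝ => (r, θ))).intervalIntegrable _ _
    let G : ℝ → ℝ := fun θ => Real.sin θ * dx F (pol r θ) - Real.cos θ * dy F (pol r θ)
    let G' : ℝ → ℝ := fun θ => r * f2 r θ + f1 r θ + r * F (pol r θ)
    have hG : ∀ θ, HasDerivAt G (G' θ) θ := by
      intro θ
      have h1 := ((Real.hasDerivAt_sin θ).mul (hasDerivAt_comp_t (hx.differentiable hne) r θ)).sub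
        ((Real.hasDerivAt_cos θ).mul (hasDerivAt_comp_t (hy.differentiable hne) r θ))
      refine h1.congr_deriv ?_
      have h2 := hE (pol r θ)
      rw [laplacian_eq] at h2
      have h3 := Real.sin_sq_add_cos_sq θ
      have h4 : F (pol r θ) = - (dx (dx F) (pol r θ) + dy (dy F) (pol r θ)) := by linarith
      simp only [G', f1, f2, h4]
      have h5 : Real.cos θ ^ 2 = 1 - Real.sin θ ^ 2 := by linarith
      ring_nf
      rw [h5]; ring
    have hcG' : IntervalIntegrable G' MeasureTheory.volume (-Real.pi) Real.pi := by
      have : Continuous (fun p : ℝ × ℝ => p.1 * f2 p.1 p.2 + f1 p.1 p.2 + p.1 * F (pol p.1 p.2)) := by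
        fun_prop
      exact slice this
    have h0 := intervalIntegral.integral_eq_sub_of_hasDerivAt (fun θ _ => hG θ) hcG'
    have hGG : G Real.pi - G (-Real.pi) = 0 := by
      simp [G, pol]
    rw [hGG] at h0
    simp only [G'] at h0
    rw [intervalIntegral.integral_add, intervalIntegral.integral_add,
      intervalIntegral.integral_const_mul, intervalIntegral.integral_const_mul] at h0
    · exact h0
    · exact (slice c2).const_mul r
    · exact slice c1
    · exact ((slice c2).const_mul r).add (slice c1)
    · exact (slice cF).const_mul r

lemma BesselODE.unique {g : ℝ → ℝ} (h : BesselODE g) (h0 : g 0 = 0) : ∀ r, 0 ≤ r → g r = 0 := by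
  obtain ⟨g1, g2, h1, h2, h3⟩ := h
  have h10 : g1 0 = 0 := by simpa using h3 0
  have hd : ∀ r, HasDerivAt (fun r => g1 r ^ 2 + g r ^ 2) (2 * g1 r * g2 r + 2 * g r * g1 r) r := by
    intro r
    refine (((h2 r).pow 2).add ((h1 r).pow 2)).congr_deriv ?_
    simp
  have hanti : AntitoneOn (fun r => g1 r ^ 2 + g r ^ 2) (Set.Ici 0) := by
    refine antitoneOn_of_deriv_nonpos (convex_Ici 0)
      (fun r _ => (hd r).continuousAt.continuousWithinAt)
      (fun r _ => (hd r).differentiableAt.differentiableWithinAt) ?_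
    intro r hr
    rw [interior_Ici] at hr
    have hr : 0 < r := hr
    rw [(hd r).deriv]
    have h4 := h3 r
    have : r * (2 * g1 r * g2 r + 2 * g r * g1 r) = - 2 * g1 r ^ 2 := by
      linear_combination 2 * g1 r * h4
    by_contra hc
    push Not at hc
    nlinarith [mul_pos hr hc, sq_nonneg (g1 r)]
  intro r hr
  have h4 := hanti (Set.self_mem_Ici (a := (0:ℝ))) hr hr
  simp only [h10, h0] at h4
  nlinarith [sq_nonneg (g1 r), sq_nonneg (g r)]

lemma BesselODE.simple {g g1 g2 : ℝ → ℝ} (h1 : ∀ r, HasDerivAt g (g1 r) r)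
    (h2 : ∀ r, HasDerivAt g1 (g2 r) r) (h3 : ∀ r, r * g2 r + g1 r + r * g r = 0)
    {z : ℝ} (hz : 0 < z) (hg : g z = 0) (hg1 : g1 z = 0) : g 0 = 0 := by
  have hd : ∀ r, HasDerivAt (fun r => r ^ 2 * (g1 r ^ 2 + g r ^ 2)) (2 * r * g r ^ 2) r := by
    intro r
    refine (((hasDerivAt_id r).pow 2).mul (((h2 r).pow 2).add ((h1 r).pow 2))).congr_deriv ?_
    simp
    linear_combination 2 * r * g1 r * h3 r
  have hmon : MonotoneOn (fun r => r ^ 2 * (g1 r ^ 2 + g r ^ 2)) (Set.Ici 0) := by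
    refine monotoneOn_of_deriv_nonneg (convex_Ici 0)
      (fun r _ => (hd r).continuousAt.continuousWithinAt)
      (fun r _ => (hd r).differentiableAt.differentiableWithinAt) ?_
    intro r hr
    rw [interior_Ici] at hr
    have hr : 0 < r := hr
    rw [(hd r).deriv]; positivity
  have hzero : ∀ r ∈ Set.Ioo 0 z, g r = 0 := by
    intro r hr
    have := hmon (Set.mem_Ici.2 hr.1.le) (Set.mem_Ici.2 hz.le) hr.2.le
    simp only [hg, hg1] at this
    have h5 : g1 r ^ 2 + g r ^ 2 ≤ 0 := by
      by_contra hc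
      push Not at hc
      nlinarith [mul_pos (pow_pos hr.1 2) hc]
    nlinarith [sq_nonneg (g1 r), sq_nonneg (g r)]
  have hcont : ContinuousWithinAt g (Set.Ioo 0 z) 0 := (h1 0).continuousAt.continuousWithinAt
  have hne : (nhdsWithin (0:ℝ) (Set.Ioo 0 z)).NeBot := by
    rw [← mem_closure_iff_nhdsWithin_neBot, closure_Ioo hz.ne]
    exact ⟨le_rfl, hz.le⟩
  refine tendsto_nhds_unique hcont ?_
  refine tendsto_const_nhds.congr' ?_
  filter_upwards [self_mem_nhdsWithin] with r hr
  exact (hzero r hr).symm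

lemma besselJ_mean (r : ℝ) : mean (fun x => Real.cos (x 1)) r = 2 * Real.pi * besselJ 0 r := by
  have hc : Continuous fun θ : ℝ => Real.cos (r * Real.sin θ) := by fun_prop
  have h : mean (fun x => Real.cos (x 1)) r = ∫ θ in (-Real.pi)..Real.pi, Real.cos (r * Real.sin θ) := by
    simp [mean, pol]
  rw [h, ← intervalIntegral.integral_add_adjacent_intervals (b := 0) (hc.intervalIntegrable _ _) (hc.intervalIntegrable _ _)]
  have h2 : ∫ θ in (-Real.pi)..0, Real.cos (r * Real.sin θ) = ∫ θ in (0:ℝ)..Real.pi, Real.cos (r * Real.sin θ) := by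
    have := intervalIntegral.integral_comp_neg (a := 0) (b := Real.pi) (fun θ => Real.cos (r * Real.sin θ))
    simp at this
    rw [this]
  rw [h2]
  simp only [besselJ]
  have : ∀ θ : ℝ, Real.cos (((0:ℕ):ℝ) * θ - r * Real.sin θ) = Real.cos (r * Real.sin θ) := by
    intro θ; simp
  simp only [this]
  field_simp [Real.pi_ne_zero]
  ring

lemma BesselODE.lin {f g : ℝ → ℝ} (hf : BesselODE f) (hg : BesselODE g) (a b : ℝ) :
    BesselODE (fun r => a * f r + b * g r) := by
  obtain ⟨f1, f2, h1, h2, h3⟩ := hf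
  obtain ⟨g1, g2, k1, k2, k3⟩ := hg
  refine ⟨fun r => a * f1 r + b * g1 r, fun r => a * f2 r + b * g2 r, ?_, ?_, ?_⟩
  · exact fun r => ((h1 r).const_mul a).add ((k1 r).const_mul b)
  · exact fun r => ((h2 r).const_mul a).add ((k2 r).const_mul b)
  · intro r; linear_combination a * h3 r + b * k3 r

lemma besselJ_ode : BesselODE (besselJ 0) := by
  have hcd : ContDiff ℝ (⊤ : ℕ∞) (fun x : E2 => Real.cos (x 1)) := by
    have : ContDiff ℝ (⊤ : ℕ∞) (fun x : E2 => x 1) := by fun_prop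
    exact Real.contDiff_cos.comp this
  have hp : ∀ x : E2, HasFDerivAt (fun x : E2 => x 1) (EuclideanSpace.proj 1 : E2 →L[ℝ] ℝ) x :=
    fun x => (EuclideanSpace.proj 1 : E2 →L[ℝ] ℝ).hasFDerivAt
  have hode := mean_ode hcd (by
    intro x
    rw [laplacian_eq]
    have e1 : dx (fun x : E2 => Real.cos (x 1)) = fun _ => 0 := by
      funext y
      simp only [dx]
      rw [((hp y).cos).fderiv]
      simp
    have e2 : dy (fun x : E2 => Real.cos (x 1)) = fun y => - Real.sin (y 1) := by
      funext y
      simp only [dy]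
      rw [((hp y).cos).fderiv]
      simp
    rw [e1, e2]
    have e3 : dx (fun _ : E2 => (0:ℝ)) x = 0 := by simp [dx]
    have e4 : dy (fun y : E2 => - Real.sin (y 1)) x = - Real.cos (x 1) := by
      simp only [dy]
      rw [((hp x).sin.fun_neg).fderiv]
      simp
    rw [e3, e4]; ring)
  have := hode.lin hode (1 / (2 * Real.pi)) 0
  have e : (fun r => 1 / (2 * Real.pi) * mean (fun x => Real.cos (x 1)) r + 0 * mean (fun x => Real.cos (x 1)) r) = besselJ 0 := by
    funext r
    rw [besselJ_mean]
    field_simp [Real.pi_ne_zero]; ring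
  rwa [e] at this

lemma besselJ_zero_zero : besselJ 0 0 = 1 := by
  simp [besselJ, Real.pi_ne_zero]

lemma mean_eq {F : E2 → ℝ} (hF : ContDiff ℝ (⊤ : ℕ∞) F) (hE : ∀ x, laplacian F x + F x = 0)
    {r : ℝ} (hr : 0 ≤ r) : mean F r = 2 * Real.pi * F 0 * besselJ 0 r := by
  have h := ((mean_ode hF hE).lin besselJ_ode 1 (-(2 * Real.pi * F 0))).unique (by
    have hp : ∀ θ, pol 0 θ = 0 := by
      intro θ; ext i; fin_cases i <;> simp [pol]
    simp [mean, besselJ_zero_zero, hp]; ring) r hr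
  linarith

lemma nonneg_of_deriv {f f' : ℝ → ℝ} (h : ∀ x, HasDerivAt f (f' x) x) (h0 : f 0 = 0)
    (hp : ∀ x, 0 ≤ x → 0 ≤ f' x) : ∀ x, 0 ≤ x → 0 ≤ f x := by
  have hm : MonotoneOn f (Set.Ici 0) := by
    refine monotoneOn_of_deriv_nonneg (convex_Ici 0)
      (fun r _ => (h r).continuousAt.continuousWithinAt)
      (fun r _ => (h r).differentiableAt.differentiableWithinAt) ?_
    intro r hr
    rw [interior_Ici] at hr
    rw [(h r).deriv]; exact hp r (le_of_lt hr)
  intro x hx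
  have := hm (Set.self_mem_Ici (a := (0:ℝ))) hx hx
  linarith

lemma cos_upper (x : ℝ) (hx : 0 ≤ x) :
    Real.cos x ≤ 1 - x ^ 2 / 2 + x ^ 4 / 24 - x ^ 6 / 720 + x ^ 8 / 40320 := by
  have p : ∀ (n : ℕ) (x : ℝ), HasDerivAt (fun x : ℝ => x ^ n) (n * x ^ (n-1)) x := fun n x => by
    simpa using hasDerivAt_pow n x
  have s2 : ∀ x : ℝ, 0 ≤ x → 0 ≤ Real.cos x - (1 - x ^ 2 / 2) := by
    intro x _; have := Real.one_sub_sq_div_two_le_cos (x := x); linarith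
  have s3 : ∀ x : ℝ, 0 ≤ x → 0 ≤ Real.sin x - (x - x ^ 3 / 6) :=
    nonneg_of_deriv (f' := fun x => Real.cos x - (1 - x ^ 2 / 2)) (fun x => by
      refine ((Real.hasDerivAt_sin x).sub ((hasDerivAt_id x).sub ((p 3 x).div_const 6))).congr_deriv ?_
      norm_num; ring) (by simp) s2
  have s4 : ∀ x : ℝ, 0 ≤ x → 0 ≤ (1 - x ^ 2 / 2 + x ^ 4 / 24) - Real.cos x :=
    nonneg_of_deriv (f' := fun x => Real.sin x - (x - x ^ 3 / 6)) (fun x => by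
      refine (((((p 2 x).div_const 2).const_sub 1).add ((p 4 x).div_const 24)).sub (Real.hasDerivAt_cos x)).congr_deriv ?_
      norm_num; ring) (by simp) s3
  have s5 : ∀ x : ℝ, 0 ≤ x → 0 ≤ (x - x ^ 3 / 6 + x ^ 5 / 120) - Real.sin x :=
    nonneg_of_deriv (f' := fun x => (1 - x ^ 2 / 2 + x ^ 4 / 24) - Real.cos x) (fun x => by
      refine ((((hasDerivAt_id x).sub ((p 3 x).div_const 6)).add ((p 5 x).div_const 120)).sub (Real.hasDerivAt_sin x)).congr_deriv ?_
      norm_num; ring) (by simp) s4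
  have s6 : ∀ x : ℝ, 0 ≤ x → 0 ≤ Real.cos x - (1 - x ^ 2 / 2 + x ^ 4 / 24 - x ^ 6 / 720) :=
    nonneg_of_deriv (f' := fun x => (x - x ^ 3 / 6 + x ^ 5 / 120) - Real.sin x) (fun x => by
      refine ((Real.hasDerivAt_cos x).sub (((((p 2 x).div_const 2).const_sub 1).add ((p 4 x).div_const 24)).sub ((p 6 x).div_const 720))).congr_deriv ?_
      norm_num; ring) (by simp) s5
  have s7 : ∀ x : ℝ, 0 ≤ x → 0 ≤ Real.sin x - (x - x ^ 3 / 6 + x ^ 5 / 120 - x ^ 7 / 5040) :=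
    nonneg_of_deriv (f' := fun x => Real.cos x - (1 - x ^ 2 / 2 + x ^ 4 / 24 - x ^ 6 / 720)) (fun x => by
      refine ((Real.hasDerivAt_sin x).sub ((((hasDerivAt_id x).sub ((p 3 x).div_const 6)).add ((p 5 x).div_const 120)).sub ((p 7 x).div_const 5040))).congr_deriv ?_
      norm_num; ring) (by simp) s6
  have s8 : ∀ x : ℝ, 0 ≤ x → 0 ≤ (1 - x ^ 2 / 2 + x ^ 4 / 24 - x ^ 6 / 720 + x ^ 8 / 40320) - Real.cos x :=
    nonneg_of_deriv (f' := fun x => Real.sin x - (x - x ^ 3 / 6 + x ^ 5 / 120 - x ^ 7 / 5040)) (fun x => by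
      refine (((((((p 2 x).div_const 2).const_sub 1).add ((p 4 x).div_const 24)).sub ((p 6 x).div_const 720)).add ((p 8 x).div_const 40320)).sub (Real.hasDerivAt_cos x)).congr_deriv ?_
      norm_num; ring) (by simp) s7
  have := s8 x hx
  linarith

lemma besselJ_eq (r : ℝ) : besselJ 0 r = (1 / Real.pi) * ∫ θ in (0:ℝ)..Real.pi, Real.cos (r * Real.sin θ) := by
  have : ∀ θ : ℝ, Real.cos (((0:ℕ):ℝ) * θ - r * Real.sin θ) = Real.cos (r * Real.sin θ) := by
    intro θ; simp
  simp only [besselJ, this]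

lemma sin_pow_ints : (∫ θ in (0:ℝ)..Real.pi, Real.sin θ ^ 2) = Real.pi / 2 ∧
    (∫ θ in (0:ℝ)..Real.pi, Real.sin θ ^ 4) = Real.pi * 3 / 8 ∧
    (∫ θ in (0:ℝ)..Real.pi, Real.sin θ ^ 6) = Real.pi * 5 / 16 ∧
    (∫ θ in (0:ℝ)..Real.pi, Real.sin θ ^ 8) = Real.pi * 35 / 128 := by
  have h2 := integral_sin_pow_even 2
  have h3 := integral_sin_pow_even 3
  have h4 := integral_sin_pow_even 4
  simp only [Finset.prod_range_succ, Finset.prod_range_zero] at h2 h3 h4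
  norm_num at h2 h3 h4
  refine ⟨by simp [integral_sin_sq], ?_, ?_, ?_⟩ <;> linarith

lemma besselJ_upper (r : ℝ) (hr : 0 ≤ r) :
    besselJ 0 r ≤ 1 - r ^ 2 / 4 + r ^ 4 / 64 - r ^ 6 / 2304 + r ^ 8 / 147456 := by
  obtain ⟨h2, h4, h6, h8⟩ := sin_pow_ints
  have hle : (∫ θ in (0:ℝ)..Real.pi, Real.cos (r * Real.sin θ)) ≤
      ∫ θ in (0:ℝ)..Real.pi, (1 - r ^ 2 / 2 * Real.sin θ ^ 2 + r ^ 4 / 24 * Real.sin θ ^ 4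
        - r ^ 6 / 720 * Real.sin θ ^ 6 + r ^ 8 / 40320 * Real.sin θ ^ 8) := by
    refine intervalIntegral.integral_mono_on Real.pi_pos.le
      (Continuous.intervalIntegrable (by fun_prop) _ _)
      (Continuous.intervalIntegrable (by fun_prop) _ _) ?_
    intro θ hθ
    have := cos_upper (r * Real.sin θ) (mul_nonneg hr (Real.sin_nonneg_of_nonneg_of_le_pi hθ.1 hθ.2))
    refine this.trans (le_of_eq ?_)
    ring
  rw [intervalIntegral.integral_add, intervalIntegral.integral_sub, intervalIntegral.integral_add,
    intervalIntegral.integral_sub, intervalIntegral.integral_const_mul, intervalIntegral.integral_const_mul,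
    intervalIntegral.integral_const_mul, intervalIntegral.integral_const_mul, h2, h4, h6, h8] at hle
  · rw [besselJ_eq, one_div, inv_mul_le_iff₀ Real.pi_pos]
    refine hle.trans (le_of_eq ?_)
    simp
    ring
  all_goals exact Continuous.intervalIntegrable (by fun_prop) _ _

lemma besselJ_lower (r : ℝ) :
    1 - r ^ 2 / 4 ≤ besselJ 0 r := by
  obtain ⟨h2, h4, h6, h8⟩ := sin_pow_ints
  have hle : (∫ θ in (0:ℝ)..Real.pi, (1 - r ^ 2 / 2 * Real.sin θ ^ 2)) ≤ (∫ θ in (0:ℝ)..Real.pi, Real.cos (r * Real.sin θ)) := by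
    refine intervalIntegral.integral_mono_on Real.pi_pos.le
      (Continuous.intervalIntegrable (by fun_prop) _ _)
      (Continuous.intervalIntegrable (by fun_prop) _ _) ?_
    intro θ hθ
    have := Real.one_sub_sq_div_two_le_cos (x := r * Real.sin θ)
    refine le_trans (le_of_eq ?_) this
    ring
  rw [intervalIntegral.integral_sub, intervalIntegral.integral_const_mul, h2] at hle
  · rw [besselJ_eq, one_div, le_inv_mul_iff₀ Real.pi_pos]
    refine le_trans (le_of_eq ?_) hle
    simp
    ring
  all_goals exact Continuous.intervalIntegrable (by fun_prop) _ _

lemma besselJ_sqrt6 : besselJ 0 (Real.sqrt 6) < 0 := by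
  have h := besselJ_upper (Real.sqrt 6) (Real.sqrt_nonneg _)
  have e : Real.sqrt 6 ^ 2 = 6 := Real.sq_sqrt (by norm_num)
  have e4 : Real.sqrt 6 ^ 4 = 36 := by
    rw [show Real.sqrt 6 ^ 4 = (Real.sqrt 6 ^ 2) ^ 2 by ring, e]; norm_num
  have e6 : Real.sqrt 6 ^ 6 = 216 := by
    rw [show Real.sqrt 6 ^ 6 = (Real.sqrt 6 ^ 2) ^ 3 by ring, e]; norm_num
  have e8 : Real.sqrt 6 ^ 8 = 1296 := by
    rw [show Real.sqrt 6 ^ 8 = (Real.sqrt 6 ^ 2) ^ 4 by ring, e]; norm_num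
  rw [e, e4, e6, e8] at h
  norm_num at h ⊢
  linarith

/-- generic next zero lemma -/
lemma next_zero {g g1 : ℝ → ℝ} (h1 : ∀ r, HasDerivAt g (g1 r) r)
    {z : ℝ} (hz : g z = 0) (hg1 : g1 z ≠ 0)
    (hS : {r : ℝ | z < r ∧ g r = 0}.Nonempty) :
    z < sInf {r : ℝ | z < r ∧ g r = 0} ∧ g (sInf {r : ℝ | z < r ∧ g r = 0}) = 0 ∧
    ∀ r, z < r → r < sInf {r : ℝ | z < r ∧ g r = 0} → g r * g1 z > 0 := by
  set S := {r : ℝ | z < r ∧ g r = 0} with hSdef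
  have hbdd : BddBelow S := ⟨z, fun r hr => hr.1.le⟩
  -- sign just right of z
  have hslope : ∀ᶠ r in nhdsWithin z (Set.Ioi z), g r * g1 z > 0 := by
    have ht := (h1 z).tendsto_slope
    have ht' : Filter.Tendsto (slope g z) (nhdsWithin z (Set.Ioi z)) (nhds (g1 z)) :=
      ht.mono_left (nhdsWithin_mono z (fun r hr => (ne_of_gt hr : r ≠ z)))
    have ht2 := ht'.mul_const (g1 z)
    have hpos : 0 < g1 z * g1 z := mul_self_pos.2 hg1
    filter_upwards [ht2.eventually (lt_mem_nhds hpos), self_mem_nhdsWithin] with r hr hrz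
    have hrz : z < r := hrz
    rw [slope_def_field, hz, sub_zero] at hr
    have h3 : 0 < r - z := by linarith
    have : g r * g1 z = (r - z) * (g r / (r - z) * g1 z) := by field_simp
    rw [this]; exact mul_pos h3 hr
  obtain ⟨b, hb, hbz⟩ := (mem_nhdsGT_iff_exists_Ioo_subset).1 hslope
  have hb : z < b := hb
  have hbS : ∀ s ∈ S, b ≤ s := by
    intro s hs
    by_contra hc
    push Not at hc
    have h5 : g s * g1 z > 0 := hbz ⟨hs.1, hc⟩
    rw [hs.2] at h5; simp at h5
  have hbI : b ≤ sInf S := le_csInf hS hbS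
  have hcont : Continuous g := continuous_iff_continuousAt.2 fun r => (h1 r).continuousAt
  have hcl : sInf S ∈ closure S := csInf_mem_closure hS hbdd
  have hgI : g (sInf S) = 0 := by
    have hclosed : IsClosed {r | g r = 0} := isClosed_eq hcont continuous_const
    exact hclosed.closure_subset_iff.2 (fun r hr => hr.2) hcl
  refine ⟨lt_of_lt_of_le hb hbI, hgI, ?_⟩
  intro r hr hrI
  by_contra hc
  push Not at hc
  have hr2 : b ≤ r := by
    by_contra h6
    push Not at h6
    have h5 : g r * g1 z > 0 := hbz ⟨hr, h6⟩
    linarith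
  -- IVT between (z+b)/2 and r
  have hmid : 0 < g ((z+b)/2) * g1 z := hbz ⟨by linarith, by linarith⟩
  have hc2 : ContinuousOn (fun s => g s * g1 z) (Set.Icc ((z+b)/2) r) := by fun_prop
  have := intermediate_value_Icc' (by linarith : (z+b)/2 ≤ r) hc2
  obtain ⟨s, hs, hs0⟩ := this ⟨hc, hmid.le⟩
  have hs0 : g s = 0 := by
    rcases mul_eq_zero.1 hs0 with h | h
    · exact h
    · exact absurd h hg1
  have hsS : s ∈ S := ⟨by linarith [hs.1], hs0⟩
  have := csInf_le hbdd hsS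
  linarith [hs.2]

lemma deriv_sign {g g1 : ℝ → ℝ} (h1 : ∀ r, HasDerivAt g (g1 r) r) {a z : ℝ} (haz : a < z)
    (hz : g z = 0) {c : ℝ} (hpos : ∀ r, a < r → r < z → 0 ≤ g r * c) : g1 z * c ≤ 0 := by
  have ht := (h1 z).tendsto_slope
  have ht' : Filter.Tendsto (slope g z) (nhdsWithin z (Set.Iio z)) (nhds (g1 z)) :=
      ht.mono_left (nhdsWithin_mono z (fun r hr => (ne_of_lt hr : r ≠ z)))
  refine le_of_tendsto (ht'.mul_const c) ?_
  filter_upwards [Ioo_mem_nhdsLT haz] with r hr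
  rw [slope_def_field, hz, sub_zero]
  have h3 := hpos r hr.1 hr.2
  have h4 : r - z < 0 := by linarith [hr.2]
  have : g r / (r - z) * c = (g r * c) / (r - z) := by ring
  rw [this]
  exact div_nonpos_of_nonneg_of_nonpos h3 h4.le

lemma bessel_facts : 2 ≤ besselJZero 0 1 ∧ besselJZero 0 1 ^ 2 ≤ 6 ∧
    (∀ r, besselJZero 0 1 < r → r < Real.sqrt 2 * besselJZero 0 1 → besselJ 0 r < 0) ∧
    (∀ r, besselJZero 0 1 < r → besselJZero 0 2 < r → r < besselJZero 0 3 → 0 < besselJ 0 r) := by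
  obtain ⟨g1, g2, h1, h2, h3⟩ := besselJ_ode
  have hcont : Continuous (besselJ 0) := continuous_iff_continuousAt.2 fun r => (h1 r).continuousAt
  have hsimple : ∀ z, 0 < z → besselJ 0 z = 0 → g1 z ≠ 0 := by
    intro z hz h0 h
    have := BesselODE.simple h1 h2 h3 hz h0 h
    rw [besselJ_zero_zero] at this; norm_num at this
  have e1 : besselJZero 0 1 = sInf {r : ℝ | 0 < r ∧ besselJ 0 r = 0} := rfl
  have e2 : besselJZero 0 2 = sInf {r : ℝ | besselJZero 0 1 < r ∧ besselJ 0 r = 0} := rfl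
  have e3 : besselJZero 0 3 = sInf {r : ℝ | besselJZero 0 2 < r ∧ besselJ 0 r = 0} := rfl
  have hzero6 : ∃ z, 0 < z ∧ z ≤ Real.sqrt 6 ∧ besselJ 0 z = 0 := by
    have := intermediate_value_Icc' (Real.sqrt_nonneg 6) hcont.continuousOn
    obtain ⟨z, hz, hz0⟩ := this ⟨besselJ_sqrt6.le, by rw [besselJ_zero_zero]; norm_num⟩
    refine ⟨z, lt_of_le_of_ne hz.1 ?_, hz.2, hz0⟩
    rintro rfl
    rw [besselJ_zero_zero] at hz0; norm_num at hz0
  obtain ⟨z, hzp, hz6, hz0⟩ := hzero6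
  have hS1 : {r : ℝ | 0 < r ∧ besselJ 0 r = 0}.Nonempty := ⟨z, hzp, hz0⟩
  have hB1 : BddBelow {r : ℝ | 0 < r ∧ besselJ 0 r = 0} := ⟨0, fun r hr => hr.1.le⟩
  have hj2 : 2 ≤ besselJZero 0 1 := by
    rw [e1]
    refine le_csInf hS1 ?_
    intro r hr
    have := besselJ_lower r
    rw [hr.2] at this
    by_contra hc
    push Not at hc
    nlinarith [hr.1]
  have hj6 : besselJZero 0 1 ≤ Real.sqrt 6 := by
    rw [e1]
    exact (csInf_le hB1 ⟨hzp, hz0⟩).trans hz6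
  have hj6' : besselJZero 0 1 ^ 2 ≤ 6 := by
    have e : Real.sqrt 6 ^ 2 = 6 := Real.sq_sqrt (by norm_num)
    rw [← e]
    exact pow_le_pow_left₀ (by linarith) hj6 2
  have hj0 : besselJ 0 (besselJZero 0 1) = 0 := by
    have hclosed : IsClosed {r | besselJ 0 r = 0} := isClosed_eq hcont continuous_const
    rw [e1]
    exact hclosed.closure_subset_iff.2 (fun r hr => hr.2) (csInf_mem_closure hS1 hB1)
  set j1 := besselJZero 0 1 with hj1def
  have hpos1 : ∀ r, 0 < r → r < j1 → 0 ≤ besselJ 0 r * 1 := by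
    intro r hr hrj
    by_contra hc
    push Not at hc
    have := intermediate_value_Icc' hr.le (hcont.continuousOn (s := Set.Icc 0 r))
    obtain ⟨s, hs, hs0⟩ := this (show (0:ℝ) ∈ _ from ⟨by linarith, by rw [besselJ_zero_zero]; norm_num⟩)
    have hs1 : 0 < s := by
      refine lt_of_le_of_ne hs.1 ?_
      rintro rfl
      rw [besselJ_zero_zero] at hs0; norm_num at hs0
    have : j1 ≤ s := by rw [e1]; exact csInf_le hB1 ⟨hs1, hs0⟩
    linarith [hs.2]
  have hd1 : g1 j1 < 0 := by
    have := deriv_sign h1 (by linarith : 0 < j1) hj0 hpos1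
    have h4 := hsimple j1 (by linarith) hj0
    exact lt_of_le_of_ne (by linarith) h4
  by_cases hS2 : {r : ℝ | j1 < r ∧ besselJ 0 r = 0}.Nonempty
  swap
  · rw [Set.not_nonempty_iff_eq_empty] at hS2
    refine ⟨hj2, hj6', ?_, ?_⟩
    · intro r hr _
      -- no zeros beyond j1; J negative right after
      by_contra hc
      push Not at hc
      have hnz : ∀ s, j1 < s → besselJ 0 s ≠ 0 := by
        intro s hs h0
        have : s ∈ ({r : ℝ | j1 < r ∧ besselJ 0 r = 0}) := ⟨hs, h0⟩
        rw [hS2] at this; exact this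
      have hrp : 0 < besselJ 0 r := lt_of_le_of_ne hc (hnz r hr).symm
      have hallp : ∀ s, j1 < s → 0 ≤ besselJ 0 s := by
        intro s hs
        by_contra hsn
        push Not at hsn
        have := isPreconnected_Ioi.intermediate_value (s := Set.Ioi j1) (a := s) (b := r) hs hr
          hcont.continuousOn
        obtain ⟨t, ht, ht0⟩ := this ⟨hsn.le, hrp.le⟩
        exact hnz t ht ht0
      have ht := (h1 j1).tendsto_slope
      have ht' : Filter.Tendsto (slope (besselJ 0) j1) (nhdsWithin j1 (Set.Ioi j1)) (nhds (g1 j1)) :=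
        ht.mono_left (nhdsWithin_mono j1 (fun r hr => (ne_of_gt hr : r ≠ j1)))
      have : 0 ≤ g1 j1 := by
        refine ge_of_tendsto ht' ?_
        filter_upwards [self_mem_nhdsWithin] with s hs
        have hs : j1 < s := hs
        rw [slope_def_field, hj0, sub_zero]
        exact div_nonneg (hallp s hs) (by linarith)
      linarith
    · intro r hr1 _ hr3
      exfalso
      rw [hS2, Real.sInf_empty] at e2
      rw [e3, e2, ← e1] at hr3
      linarith
  · obtain ⟨k1, k2, k3⟩ := next_zero h1 hj0 hd1.ne hS2
    rw [← e2] at k1 k2 k3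
    set j2 := besselJZero 0 2 with hj2def
    have hneg : ∀ r, j1 < r → r < j2 → besselJ 0 r < 0 := by
      intro r hr hr2
      have := k3 r hr hr2
      by_contra hc
      push Not at hc
      nlinarith
    have hd2 : 0 < g1 j2 := by
      have := deriv_sign (c := -1) h1 k1 k2 (fun r hr hr2 => by have := hneg r hr hr2; linarith)
      have h4 := hsimple j2 (by linarith) k2
      exact lt_of_le_of_ne (by linarith) h4.symm
    refine ⟨hj2, hj6', ?_, ?_⟩
    · intro r hr hrs
      refine hneg r hr ?_
      by_contra hc
      push Not at hc
      -- barrier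
      have hj2s : j2 ^ 2 < 2 * j1 ^ 2 := by
        have h5 : j2 < Real.sqrt 2 * j1 := lt_of_le_of_lt hc hrs
        have h6 : j2 ^ 2 < (Real.sqrt 2 * j1) ^ 2 := pow_lt_pow_left₀ h5 (by linarith) (by norm_num)
        rw [mul_pow, Real.sq_sqrt (by norm_num)] at h6
        exact h6
      set c := j1 ^ 2 + 3 with hcdef
      let w : ℝ → ℝ := fun r => 10 - (r ^ 2 - c) ^ 2
      have hw : ∀ r, HasDerivAt w (-4 * r * (r ^ 2 - c)) r := by
        intro r
        refine (((((hasDerivAt_id r).pow 2).sub_const c).pow 2).const_sub 10).congr_deriv ?_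
        simp; ring
      have hw1 : ∀ r, HasDerivAt (fun r => -4 * r * (r ^ 2 - c)) (-4 * (r ^ 2 - c) - 8 * r ^ 2) r := by
        intro r
        refine (((hasDerivAt_id r).const_mul (-4)).mul (((hasDerivAt_id r).pow 2).sub_const c)).congr_deriv ?_
        simp; ring
      let W : ℝ → ℝ := fun r => r * (g1 r * w r - besselJ 0 r * (-4 * r * (r ^ 2 - c)))
      have hW : ∀ r, HasDerivAt W (- (r * besselJ 0 r) * (w r - 8 * (2 * r ^ 2 - c))) r := by
        intro r
        refine ((hasDerivAt_id r).mul (((h2 r).mul (hw r)).sub ((h1 r).mul (hw1 r)))).congr_deriv ?_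
        simp only [id, Pi.sub_apply, Pi.mul_apply]
        linear_combination (w r) * h3 r
      have hanti : AntitoneOn W (Set.Icc j1 j2) := by
        refine antitoneOn_of_deriv_nonpos (convex_Icc _ _)
          (fun r _ => (hW r).continuousAt.continuousWithinAt)
          (fun r _ => (hW r).differentiableAt.differentiableWithinAt) ?_
        intro s hs
        rw [interior_Icc] at hs
        rw [(hW s).deriv]
        have hn := hneg s hs.1 hs.2
        have hs0 : 0 < s := by linarith [hs.1]
        have h7 : j1 ^ 2 < s ^ 2 := pow_lt_pow_left₀ hs.1 (by linarith) (by norm_num)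
        have h8 : w s - 8 * (2 * s ^ 2 - c) ≤ 0 := by
          simp only [w, hcdef]
          nlinarith [sq_nonneg (s ^ 2 - j1 ^ 2), h7, hj2]
        have h9 : s * besselJ 0 s ≤ 0 := by nlinarith
        nlinarith
      have hfin := hanti (Set.left_mem_Icc.2 k1.le) (Set.right_mem_Icc.2 k1.le) k1.le
      simp only [W, k2, hj0, zero_mul, sub_zero] at hfin
      have hw1p : 0 < w j1 := by simp only [w, hcdef]; norm_num
      have hw2p : 0 < w j2 := by
        have h7 : j1 ^ 2 < j2 ^ 2 := pow_lt_pow_left₀ k1 (by linarith) (by norm_num)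
        simp only [w, hcdef]; nlinarith
      have : 0 < j2 * (g1 j2 * w j2) := mul_pos (by linarith) (mul_pos hd2 hw2p)
      have : 0 < j1 * ((- g1 j1) * w j1) := mul_pos (by linarith) (mul_pos (by linarith) hw1p)
      nlinarith
    · intro r hr1 hr2 hr3
      by_cases hS3 : {r : ℝ | j2 < r ∧ besselJ 0 r = 0}.Nonempty
      · obtain ⟨l1, l2, l3⟩ := next_zero h1 k2 hd2.ne' hS3
        rw [← e3] at l1 l2 l3
        have := l3 r hr2 hr3
        by_contra hc
        push Not at hc
        nlinarith
      · rw [Set.not_nonempty_iff_eq_empty] at hS3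
        rw [hS3, Real.sInf_empty] at e3
        linarith

lemma wirtinger_dirichlet {v v' : ℝ → ℝ} (hv : ∀ x, HasDerivAt v (v' x) x) (hc : Continuous v')
    {a : ℝ} (ha : v a = 0) (hb : v (a + Real.pi) = 0) :
    ∫ x in a..(a + Real.pi), v x ^ 2 ≤ ∫ x in a..(a + Real.pi), v' x ^ 2 := by
  have hcv : Continuous v := continuous_iff_continuousAt.2 fun r => (hv r).continuousAt
  have hpi := Real.pi_pos
  have key : ∀ κ ∈ Set.Ioo (0:ℝ) 1, κ ^ 2 * (∫ x in a..(a + Real.pi), v x ^ 2) ≤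
      ∫ x in a..(a + Real.pi), v' x ^ 2 := by
    intro κ hκ
    set c := a + Real.pi / 2
    have hcos : ∀ x ∈ Set.Icc a (a + Real.pi), 0 < Real.cos (κ * (x - c)) := by
      intro x hx
      refine Real.cos_pos_of_mem_Ioo ⟨?_, ?_⟩
      · have h1 : -(Real.pi/2) ≤ x - c := by simp only [c]; linarith [hx.1]
        nlinarith [hκ.1, hκ.2]
      · have h1 : x - c ≤ Real.pi/2 := by simp only [c]; linarith [hx.2]
        nlinarith [hκ.1, hκ.2]
    let H : ℝ → ℝ := fun x => - κ * Real.tan (κ * (x - c))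
    have hH : ∀ x ∈ Set.Icc a (a + Real.pi), HasDerivAt H (- κ ^ 2 - H x ^ 2) x := by
      intro x hx
      have h0 := (hcos x hx).ne'
      have h1 : HasDerivAt (fun x => κ * (x - c)) κ x := by
        simpa using ((hasDerivAt_id x).sub_const c).const_mul κ
      refine (((Real.hasDerivAt_tan h0).comp x h1).const_mul (-κ)).congr_deriv ?_
      simp only [H]
      rw [Real.tan_eq_sin_div_cos]
      field_simp
      have := Real.sin_sq_add_cos_sq (κ * (x - c))
      linear_combination κ^2 * this
    have hg : ∀ x ∈ Set.Icc a (a + Real.pi), HasDerivAt (fun x => H x * v x ^ 2)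
        ((- κ ^ 2 - H x ^ 2) * v x ^ 2 + H x * (2 * v x * v' x)) x := by
      intro x hx
      refine ((hH x hx).mul ((hv x).pow 2)).congr_deriv ?_
      simp
    have h2 := sub_le_integral_of_hasDeriv_right_of_le (g := fun x => H x * v x ^ 2)
      (g' := fun x => (- κ ^ 2 - H x ^ 2) * v x ^ 2 + H x * (2 * v x * v' x))
      (φ := fun x => v' x ^ 2 - κ ^ 2 * v x ^ 2) (by linarith : a ≤ a + Real.pi)
      (fun x hx => (hg x hx).continuousAt.continuousWithinAt)
      (fun x hx => (hg x (Set.Ioo_subset_Icc_self hx)).hasDerivWithinAt)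
      (Continuous.integrableOn_Icc (by fun_prop))
      (fun x hx => by nlinarith [sq_nonneg (v' x - H x * v x)])
    simp only [ha, hb] at h2
    rw [intervalIntegral.integral_sub (Continuous.intervalIntegrable (by fun_prop) _ _)
      (Continuous.intervalIntegrable (by fun_prop) _ _), intervalIntegral.integral_const_mul] at h2
    linarith
  have ht : Filter.Tendsto (fun κ : ℝ => κ ^ 2 * (∫ x in a..(a + Real.pi), v x ^ 2))
      (nhdsWithin 1 (Set.Iio 1)) (nhds (1 ^ 2 * (∫ x in a..(a + Real.pi), v x ^ 2))) := by
    refine Filter.Tendsto.mono_left ?_ nhdsWithin_le_nhds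
    exact (Continuous.tendsto (by fun_prop) 1)
  have := le_of_tendsto ht (by
    filter_upwards [Ioo_mem_nhdsLT (by norm_num : (0:ℝ) < 1)] with κ hκ
    exact key κ hκ)
  simpa using this

lemma var_eq {f : ℝ → ℝ} (hf : Continuous f) (c : ℝ) :
    ∫ x in (-Real.pi)..Real.pi, (f x - c) ^ 2 =
      (∫ x in (-Real.pi)..Real.pi, f x ^ 2) - 2 * c * (∫ x in (-Real.pi)..Real.pi, f x)
        + 2 * Real.pi * c ^ 2 := by
  have : ∀ x, (f x - c) ^ 2 = f x ^ 2 - 2 * c * f x + c ^ 2 := fun x => by ring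
  simp only [this]
  rw [intervalIntegral.integral_add, intervalIntegral.integral_sub, intervalIntegral.integral_const_mul,
    intervalIntegral.integral_const]
  · rw [smul_eq_mul]; ring
  all_goals exact Continuous.intervalIntegrable (by fun_prop) _ _

lemma wirtinger {v v' : ℝ → ℝ} (hv : ∀ x, HasDerivAt v (v' x) x) (hc : Continuous v')
    (hp : Function.Periodic v (2 * Real.pi)) (hp' : Function.Periodic v' (2 * Real.pi))
    {A : ℝ} (hA : 2 * Real.pi * A = ∫ x in (-Real.pi)..Real.pi, v x) :
    (∫ x in (-Real.pi)..Real.pi, v x ^ 2) - 2 * Real.pi * A ^ 2 ≤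
      ∫ x in (-Real.pi)..Real.pi, v' x ^ 2 := by
  have hcv : Continuous v := continuous_iff_continuousAt.2 fun r => (hv r).continuousAt
  have hpi := Real.pi_pos
  -- find a with v a = v (a+π)
  obtain ⟨a, ha⟩ : ∃ a, v (a + Real.pi) = v a := by
    let g : ℝ → ℝ := fun x => v (x + Real.pi) - v x
    have hg : Continuous g := by simp only [g]; fun_prop
    have h1 : g Real.pi = - g 0 := by
      simp only [g]
      have := hp 0
      rw [show Real.pi + Real.pi = 0 + 2 * Real.pi by ring, this]; simp
    have : (0:ℝ) ∈ Set.range g := by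
      rcases le_total (g 0) 0 with h | h
      · exact mem_range_of_exists_le_of_exists_ge hg ⟨0, h⟩ ⟨Real.pi, by linarith⟩
      · exact mem_range_of_exists_le_of_exists_ge hg ⟨Real.pi, by linarith⟩ ⟨0, h⟩
    obtain ⟨a, ha⟩ := this
    exact ⟨a, by simp only [g] at ha; linarith⟩
  set c := v a with hcdef
  have hw : ∀ x, HasDerivAt (fun x => v x - c) (v' x) x := fun x => (hv x).sub_const c
  have i1 := wirtinger_dirichlet (a := a) hw hc (by simp [hcdef]) (by simp [ha])
  have i2 := wirtinger_dirichlet (a := a + Real.pi) hw hc (by simp [ha]) (by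
    rw [show a + Real.pi + Real.pi = a + 2 * Real.pi by ring, hp a]; simp [hcdef])
  have c1 : Continuous fun x => (v x - c) ^ 2 := by fun_prop
  have c2 : Continuous fun x => v' x ^ 2 := by fun_prop
  have e1 := intervalIntegral.integral_add_adjacent_intervals (a := a) (b := a + Real.pi)
    (c := a + Real.pi + Real.pi) (c1.intervalIntegrable _ _) (c1.intervalIntegrable _ _)
    (μ := MeasureTheory.volume)
  have e2 := intervalIntegral.integral_add_adjacent_intervals (a := a) (b := a + Real.pi)
    (c := a + Real.pi + Real.pi) (c2.intervalIntegrable _ _) (c2.intervalIntegrable _ _)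
    (μ := MeasureTheory.volume)
  have q1 : Function.Periodic (fun x => (v x - c) ^ 2) (2 * Real.pi) := fun x => by
    simp only [hp x]
  have q2 : Function.Periodic (fun x => v' x ^ 2) (2 * Real.pi) := fun x => by
    simp only [hp' x]
  have f1 := q1.intervalIntegral_add_eq a (-Real.pi)
  have f2 := q2.intervalIntegral_add_eq a (-Real.pi)
  rw [show a + Real.pi + Real.pi = a + 2 * Real.pi by ring] at e1 e2 i2
  rw [show -Real.pi + 2 * Real.pi = Real.pi by ring] at f1 f2
  have := var_eq hcv c
  rw [← hA] at this
  nlinarith [mul_nonneg hpi.le (sq_nonneg (A - c))]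

lemma var_nonneg {f : ℝ → ℝ} (hf : Continuous f) {A : ℝ}
    (hA : 2 * Real.pi * A = ∫ x in (-Real.pi)..Real.pi, f x) :
    0 ≤ (∫ x in (-Real.pi)..Real.pi, f x ^ 2) - 2 * Real.pi * A ^ 2 := by
  have h := var_eq hf A
  have h2 : 0 ≤ ∫ x in (-Real.pi)..Real.pi, (f x - A) ^ 2 :=
    intervalIntegral.integral_nonneg (by linarith [Real.pi_pos]) (fun x _ => sq_nonneg _)
  rw [← hA] at h
  nlinarith

lemma picone_pt {r X Y N H H' κ : ℝ} (hr : 0 < r) (hN : 0 ≤ N)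
    (hX : ∀ h : ℝ, 0 ≤ X - 2 * h * Y + h ^ 2 * N)
    (hH : H' + H ^ 2 / r ≤ κ / r - (13/12) * r) :
    H' * N + H * (2 * Y) ≤ r * X + κ * N / r - 13/12 * r * N := by
  have h1 := mul_nonneg hr.le (hX (H / r))
  have h2 : r * (X - 2 * (H / r) * Y + (H / r) ^ 2 * N) = r * X - 2 * H * Y + H ^ 2 / r * N := by
    field_simp
  have h3 := mul_le_mul_of_nonneg_right hH hN
  rw [h2] at h1
  have h4 : κ * N / r = κ / r * N := by ring
  rw [h4]
  nlinarith

/-- barrier for the first angular mode -/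
noncomputable def pp (s : ℝ) : ℝ := 1 - s / 8 + s ^ 2 / 192 - s ^ 3 / 9216
noncomputable def nn (s : ℝ) : ℝ := 1 - 3 * s / 8 + 5 * s ^ 2 / 192 - 7 * s ^ 3 / 9216

lemma pp_pos {s : ℝ} (hs : s ≤ 13) : 0 < pp s := by
  have : pp s = ((16 - s) ^ 3 + 384 * (16 - s) - 1024) / 9216 := by unfold pp; ring
  rw [this]
  have h : 27 ≤ (16 - s) ^ 3 := by
    have := pow_le_pow_left₀ (by norm_num : (0:ℝ) ≤ 3) (by linarith : 3 ≤ 16 - s) 3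
    linarith
  apply div_pos _ (by norm_num)
  linarith

lemma H1_spec {r : ℝ} (hr : 0 ≤ r) (hr2 : r ^ 2 ≤ 12) :
    ∃ H', HasDerivAt (fun r : ℝ => nn (13/12 * r ^ 2) / pp (13/12 * r ^ 2)) H' r ∧
      (0 < r → H' + (nn (13/12 * r ^ 2) / pp (13/12 * r ^ 2)) ^ 2 / r ≤ 1 / r - (13/12) * r) := by
  have hs : HasDerivAt (fun r : ℝ => 13/12 * r ^ 2) (13/6 * r) r := by
    refine ((hasDerivAt_pow 2 r).const_mul (13/12)).congr_deriv ?_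
    norm_num; ring
  have hn : ∀ s, HasDerivAt nn (-3/8 + 5 * s / 96 - 7 * s ^ 2 / 3072) s := by
    intro s
    unfold nn
    refine ((((((hasDerivAt_id s).const_mul 3).div_const 8).const_sub 1).add
      (((hasDerivAt_pow 2 s).const_mul 5).div_const 192)).sub
      (((hasDerivAt_pow 3 s).const_mul 7).div_const 9216)).congr_deriv ?_
    norm_num; ring
  have hp : ∀ s, HasDerivAt pp (-1/8 + s / 96 - s ^ 2 / 3072) s := by
    intro s
    unfold pp
    refine (((((hasDerivAt_id s).div_const 8).const_sub 1).add
      ((hasDerivAt_pow 2 s).div_const 192)).sub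
      ((hasDerivAt_pow 3 s).div_const 9216)).congr_deriv ?_
    norm_num; ring
  have hpos : 0 < pp (13/12 * r ^ 2) := pp_pos (by linarith)
  refine ⟨_, ((hn _).comp r hs).div ((hp _).comp r hs) hpos.ne', ?_⟩
  intro hr0
  set s := 13/12 * r ^ 2 with hsdef
  have hs0 : 0 ≤ s := by positivity
  have key : (2 * s) * ((-3/8 + 5 * s / 96 - 7 * s ^ 2 / 3072) * pp s - nn s * (-1/8 + s / 96 - s ^ 2 / 3072))
      + nn s ^ 2 = (1 - s) * pp s ^ 2 - pp s * s ^ 4 / 9216 := by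
    unfold pp nn; ring
  have e : (1 / r - (13/12) * r) - (((-3/8 + 5 * s / 96 - 7 * s ^ 2 / 3072) * (13/6 * r) * pp s - nn s * ((-1/8 + s / 96 - s ^ 2 / 3072) * (13/6 * r))) / pp s ^ 2 + (nn s / pp s) ^ 2 / r) = (s ^ 4 / 9216) / (r * pp s) := by
    have h1 : r ^ 2 = 12 / 13 * s := by rw [hsdef]; ring
    have h2 : (1 - s) * pp s ^ 2 - (2 * s) * ((-3/8 + 5 * s / 96 - 7 * s ^ 2 / 3072) * pp s - nn s * (-1/8 + s / 96 - s ^ 2 / 3072))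
      - nn s ^ 2 = pp s * s ^ 4 / 9216 := by linarith
    have h3 : s ^ 4 / 9216 / (r * pp s) = (pp s * s ^ 4 / 9216) / (r * pp s ^ 2) := by
      field_simp
    rw [h3, ← h2]
    have h4 : (1 / r - (13/12) * r) = (1 - s) / r := by
      rw [hsdef]; field_simp
    have h5 : ((-3/8 + 5 * s / 96 - 7 * s ^ 2 / 3072) * (13/6 * r) * pp s - nn s * ((-1/8 + s / 96 - s ^ 2 / 3072) * (13/6 * r))) = (2 * s) * ((-3/8 + 5 * s / 96 - 7 * s ^ 2 / 3072) * pp s - nn s * (-1/8 + s / 96 - s ^ 2 / 3072)) / r := by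
      rw [eq_div_iff hr0.ne', hsdef]; ring
    rw [h4, h5]
    generalize ((-3/8 + 5 * s / 96 - 7 * s ^ 2 / 3072) * pp s - nn s * (-1/8 + s / 96 - s ^ 2 / 3072)) = Q
    generalize pp s = p at *
    generalize nn s = n
    field_simp
    ring
  have : 0 ≤ (s ^ 4 / 9216) / (r * pp s) := by positivity
  rw [← e] at this
  simp only [Function.comp]
  linarith

lemma H0_spec {r : ℝ} (hr : 0 ≤ r) (hr2 : r ≤ 19/10) :
    ∃ H', HasDerivAt (fun r : ℝ => (-(13/24) * r ^ 2) / (1 - 13/48 * r ^ 2)) H' r ∧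
      (0 < r → H' + ((-(13/24) * r ^ 2) / (1 - 13/48 * r ^ 2)) ^ 2 / r ≤ 0 / r - (13/12) * r) := by
  have hp : 0 < 1 - 13/48 * r ^ 2 := by nlinarith
  refine ⟨_, (((hasDerivAt_pow 2 r).const_mul (-(13/24)))).div
    (((hasDerivAt_pow 2 r).const_mul (13/48)).const_sub 1) hp.ne', ?_⟩
  intro hr0
  norm_num
  have e : -(13 / 12 * r) - ((-(13 / 24 * (2 * r) * (1 - 13 / 48 * r ^ 2)) - 13 / 24 * r ^ 2 * (13 / 48 * (2 * r))) / (1 - 13 / 48 * r ^ 2) ^ 2 + (-(13 / 24 * r ^ 2) / (1 - 13 / 48 * r ^ 2)) ^ 2 / r) = (13/12 * 13 / 48) * r ^ 3 / (1 - 13/48 * r ^ 2) := by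
    have h1 := hp.ne'
    have h1' : 48 - 13 * r ^ 2 ≠ 0 := by
      intro h; apply h1; linarith
    field_simp
    ring
  have : 0 ≤ (13/12 * 13 / 48) * r ^ 3 / (1 - 13/48 * r ^ 2) := by positivity
  rw [← e] at this
  linarith

lemma H2_spec {r : ℝ} (hr : 19/10 ≤ r) (hr2 : r ^ 2 ≤ 12) :
    ∃ H', HasDerivAt (fun r : ℝ => (-(7/5) * r * (r - 27/10)) / (1 - 7/10 * (r - 27/10) ^ 2)) H' r ∧
      (0 < r → H' + ((-(7/5) * r * (r - 27/10)) / (1 - 7/10 * (r - 27/10) ^ 2)) ^ 2 / r ≤ 0 / r - (13/12) * r) := by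
  have hr3 : r ≤ 347/100 := by nlinarith
  have hp : 0 < 1 - 7/10 * (r - 27/10) ^ 2 := by nlinarith
  have hd : HasDerivAt (fun r : ℝ => -(7/5) * r * (r - 27/10)) (-(7/5) * (2 * r - 27/10)) r := by
    refine (((hasDerivAt_id r).const_mul (-(7/5))).mul ((hasDerivAt_id r).sub_const (27/10))).congr_deriv ?_
    simp; ring
  have hd2 : HasDerivAt (fun r : ℝ => 1 - 7/10 * (r - 27/10) ^ 2) (-(7/5) * (r - 27/10)) r := by
    refine (((((hasDerivAt_id r).sub_const (27/10)).pow 2).const_mul (7/10)).const_sub 1).congr_deriv ?_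
    simp; ring
  refine ⟨_, hd.div hd2 hp.ne', ?_⟩
  intro hr0
  have hpoly : -(7/5) * (2 * r - 27/10) + 13/12 * r * (1 - 7/10 * (r - 27/10) ^ 2) ≤ 0 := by
    nlinarith [mul_nonneg (sub_nonneg.2 hr) (sub_nonneg.2 hr3), mul_nonneg (mul_nonneg (sub_nonneg.2 hr) (sub_nonneg.2 hr3)) hr0.le, sq_nonneg (r - 2), sq_nonneg (r-23/10), mul_nonneg hr0.le (sq_nonneg (r - 2)), mul_nonneg hr0.le (sq_nonneg (r - 5/2))]
  generalize hw : 1 - 7/10 * (r - 27/10) ^ 2 = w at *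
  have e : 0 / r - (13/12) * r - ((-(7/5) * (2 * r - 27/10) * w - -(7/5) * r * (r - 27/10) * (-(7/5) * (r - 27/10))) / w ^ 2 + (-(7/5) * r * (r - 27/10) / w) ^ 2 / r) = - (-(7/5) * (2 * r - 27/10) + 13/12 * r * w) / w := by
    field_simp
    ring
  have : 0 ≤ - (-(7/5) * (2 * r - 27/10) + 13/12 * r * w) / w :=
    div_nonneg (by linarith) hp.le
  rw [← e] at this
  linarith

noncomputable def Psi (u : E2 → ℝ) (H : ℝ → ℝ) (r : ℝ) : ℝ :=
  (nn (13/12 * r ^ 2) / pp (13/12 * r ^ 2)) *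
    ((∫ θ in (-Real.pi)..Real.pi, u (pol r θ) ^ 2) - 2 * Real.pi * (mean u r / (2 * Real.pi)) ^ 2)
  + 2 * Real.pi * (H r * (mean u r / (2 * Real.pi)) ^ 2)

@[fun_prop] lemma continuous_pol' {X : Type*} [TopologicalSpace X] {f g : X → ℝ}
    (hf : Continuous f) (hg : Continuous g) : Continuous fun x => pol (f x) (g x) :=
  continuous_pol.comp (hf.prodMk hg)

lemma pol_periodic (r : ℝ) : Function.Periodic (pol r) (2 * Real.pi) := by
  intro θ; simp [pol]

set_option maxHeartbeats 1000000 in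
lemma radial_step {u : E2 → ℝ} (hu : ContDiff ℝ 1 u) {a b : ℝ} (ha : 0 ≤ a) (hab : a ≤ b)
    (hb : b ^ 2 ≤ 12) (H : ℝ → ℝ)
    (hH : ∀ r ∈ Set.Icc a b, ∃ H', HasDerivAt H H' r ∧
      (0 < r → H' + H r ^ 2 / r ≤ 0 / r - (13/12) * r)) :
    Psi u H b - Psi u H a ≤ ∫ r in a..b, r * ∫ θ in (-Real.pi)..Real.pi,
      (dx u (pol r θ) ^ 2 + dy u (pol r θ) ^ 2 - 13/12 * u (pol r θ) ^ 2) := by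
  have hd : Differentiable ℝ u := hu.differentiable (by norm_num)
  have hcu : Continuous u := hd.continuous
  have hcx : Continuous (dx u) := (hu.continuous_fderiv (by norm_num)).clm_apply continuous_const
  have hcy : Continuous (dy u) := (hu.continuous_fderiv (by norm_num)).clm_apply continuous_const
  have hp := Real.pi_pos
  have cU : Continuous (fun p : ℝ × ℝ => u (pol p.1 p.2)) := hcu.comp continuous_pol
  have cX : Continuous (fun p : ℝ × ℝ => dx u (pol p.1 p.2)) := hcx.comp continuous_pol
  have cY : Continuous (fun p : ℝ × ℝ => dy u (pol p.1 p.2)) := hcy.comp continuous_pol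
  let Ur : ℝ → ℝ → ℝ := fun r θ => Real.cos θ * dx u (pol r θ) + Real.sin θ * dy u (pol r θ)
  let T : ℝ → ℝ → ℝ := fun r θ => - Real.sin θ * dx u (pol r θ) + Real.cos θ * dy u (pol r θ)
  have cUr : Continuous (fun p : ℝ × ℝ => Ur p.1 p.2) := by simp only [Ur]; fun_prop
  have cT : Continuous (fun p : ℝ × ℝ => T p.1 p.2) := by simp only [T]; fun_prop
  have sl : ∀ {f : ℝ → ℝ → ℝ}, Continuous (fun p : ℝ × ℝ => f p.1 p.2) → ∀ r, Continuous (f r) := by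
    intro f hf r
    exact hf.comp (by fun_prop : Continuous fun θ : ℝ => ((r, θ) : ℝ × ℝ))
  have cU1 := fun r => sl (f := fun r θ => u (pol r θ)) cU r
  have cX1 := fun r => sl (f := fun r θ => dx u (pol r θ)) cX r
  have cY1 := fun r => sl (f := fun r θ => dy u (pol r θ)) cY r
  have cUr1 := fun r => sl cUr r
  have cT1 := fun r => sl cT r
  have hm : ∀ r, HasDerivAt (mean u) (∫ θ in (-Real.pi)..Real.pi, Ur r θ) r := fun r =>
    hasDerivAt_param (fun r θ => u (pol r θ)) Ur (fun r θ => hasDerivAt_comp_r hd r θ) cU cUr _ _ r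
  have hs : ∀ r, HasDerivAt (fun r => ∫ θ in (-Real.pi)..Real.pi, u (pol r θ) ^ 2)
      (∫ θ in (-Real.pi)..Real.pi, 2 * (u (pol r θ) * Ur r θ)) r := fun r =>
    hasDerivAt_param (fun r θ => u (pol r θ) ^ 2) (fun r θ => 2 * (u (pol r θ) * Ur r θ))
      (fun r θ => ((hasDerivAt_comp_r hd r θ).pow 2).congr_deriv (by simp [Ur]; ring))
      (by fun_prop) (by fun_prop) _ _ r
  have main : ∀ r ∈ Set.Icc a b, ∃ D, HasDerivAt (Psi u H) D r ∧ (0 < r → D ≤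
      r * ∫ θ in (-Real.pi)..Real.pi,
      (dx u (pol r θ) ^ 2 + dy u (pol r θ) ^ 2 - 13/12 * u (pol r θ) ^ 2)) := by
    intro r hr
    have hr12 : r ^ 2 ≤ 12 := by nlinarith [hr.1, hr.2]
    obtain ⟨H0', h0, h0i⟩ := hH r hr
    obtain ⟨H1', h1, h1i⟩ := H1_spec (ha.trans hr.1) hr12
    have hA := (hm r).div_const (2 * Real.pi)
    refine ⟨_, (h1.mul ((hs r).sub ((hA.pow 2).const_mul (2 * Real.pi)))).add
      ((h0.mul (hA.pow 2)).const_mul (2 * Real.pi)), ?_⟩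
    intro hr0
    specialize h0i hr0
    specialize h1i hr0
    have eI : (∫ θ in (-Real.pi)..Real.pi,
        (dx u (pol r θ) ^ 2 + dy u (pol r θ) ^ 2 - 13/12 * u (pol r θ) ^ 2)) =
        (∫ θ in (-Real.pi)..Real.pi, Ur r θ ^ 2) + (∫ θ in (-Real.pi)..Real.pi, T r θ ^ 2)
          - 13/12 * ∫ θ in (-Real.pi)..Real.pi, u (pol r θ) ^ 2 := by
      rw [← intervalIntegral.integral_const_mul, ← intervalIntegral.integral_add,
        ← intervalIntegral.integral_sub]
      · congr 1; ext θ
        simp only [Ur, T]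
        have := Real.sin_sq_add_cos_sq θ
        linear_combination (- dx u (pol r θ) ^ 2 - dy u (pol r θ) ^ 2) * this
      all_goals exact Continuous.intervalIntegrable (by fun_prop) _ _
    have hw := wirtinger (v := fun θ => u (pol r θ)) (v' := fun θ => r * T r θ)
      (fun θ => hasDerivAt_comp_t hd r θ) (by fun_prop)
      (fun θ => by simp only [pol_periodic r θ])
      (fun θ => by simp only [T, pol_periodic r θ, Real.sin_add_two_pi, Real.cos_add_two_pi])
      (A := mean u r / (2 * Real.pi)) (by rw [mul_div_cancel₀ _ (by positivity)]; rfl)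
    have hN := var_nonneg (cU1 r) (A := mean u r / (2 * Real.pi))
      (by rw [mul_div_cancel₀ _ (by positivity)]; rfl)
    have hX : ∀ h : ℝ, 0 ≤ (∫ θ in (-Real.pi)..Real.pi, (Ur r θ - h * u (pol r θ)) ^ 2)
        - 2 * Real.pi * ((∫ θ in (-Real.pi)..Real.pi, Ur r θ) / (2 * Real.pi) -
          h * (mean u r / (2 * Real.pi))) ^ 2 := by
      intro h
      refine var_nonneg (by fun_prop) ?_
      rw [intervalIntegral.integral_sub (Continuous.intervalIntegrable (by fun_prop) _ _)
        (Continuous.intervalIntegrable (by fun_prop) _ _), intervalIntegral.integral_const_mul]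
      change _ = _ - h * mean u r
      field_simp
    have eX : ∀ h : ℝ, (∫ θ in (-Real.pi)..Real.pi, (Ur r θ - h * u (pol r θ)) ^ 2) =
        (∫ θ in (-Real.pi)..Real.pi, Ur r θ ^ 2) - 2 * h * (∫ θ in (-Real.pi)..Real.pi, u (pol r θ) * Ur r θ)
        + h ^ 2 * ∫ θ in (-Real.pi)..Real.pi, u (pol r θ) ^ 2 := by
      intro h
      rw [← intervalIntegral.integral_const_mul, ← intervalIntegral.integral_const_mul,
        ← intervalIntegral.integral_sub, ← intervalIntegral.integral_add]
      · congr 1; ext θ; ring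
      all_goals exact Continuous.intervalIntegrable (by fun_prop) _ _
    have eT : (∫ θ in (-Real.pi)..Real.pi, (r * T r θ) ^ 2) = r ^ 2 * ∫ θ in (-Real.pi)..Real.pi, T r θ ^ 2 := by
      simp only [mul_pow, intervalIntegral.integral_const_mul]
    rw [eI, intervalIntegral.integral_const_mul]
    rw [eT] at hw
    simp only [eX] at hX
    set A := mean u r / (2 * Real.pi)
    set A1 := (∫ θ in (-Real.pi)..Real.pi, Ur r θ) / (2 * Real.pi)
    set S := ∫ θ in (-Real.pi)..Real.pi, u (pol r θ) ^ 2
    set Y := ∫ θ in (-Real.pi)..Real.pi, u (pol r θ) * Ur r θ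
    set X := ∫ θ in (-Real.pi)..Real.pi, Ur r θ ^ 2
    set W := ∫ θ in (-Real.pi)..Real.pi, T r θ ^ 2
    have p1 := picone_pt (X := X - 2 * Real.pi * A1 ^ 2) (Y := Y - 2 * Real.pi * A * A1) hr0 hN
      (fun h => by have := hX h; nlinarith) h1i
    have p0 := picone_pt (X := A1 ^ 2) (Y := A * A1) (N := A ^ 2) hr0 (sq_nonneg _)
      (fun h => by nlinarith [sq_nonneg (A1 - h * A)]) h0i
    have hw' : 1 * (S - 2 * Real.pi * A ^ 2) / r ≤ r * W := by
      rw [div_le_iff₀ hr0]; nlinarith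
    have p0' := mul_le_mul_of_nonneg_left p0 (by positivity : 0 ≤ 2 * Real.pi)
    simp only [zero_mul, zero_div] at p0'
    simp only [Nat.cast_ofNat, Nat.add_one_sub_one, pow_one, Pi.pow_apply, Pi.sub_apply, Pi.mul_apply, Pi.div_apply]
    change H1' * (S - 2 * Real.pi * A ^ 2) + _ * (2 * Y - _) + _ ≤ _
    nlinarith
  choose! D hD1 hD2 using main
  have hc : Continuous (fun r => r * ∫ θ in (-Real.pi)..Real.pi,
      (dx u (pol r θ) ^ 2 + dy u (pol r θ) ^ 2 - 13/12 * u (pol r θ) ^ 2)) := by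
    refine continuous_id.mul ?_
    exact intervalIntegral.continuous_parametric_intervalIntegral_of_continuous' (by
      simp only [Function.uncurry_def]; fun_prop) _ _
  exact sub_le_integral_of_hasDeriv_right_of_le (g := Psi u H) (g' := D) (φ := fun r => r * ∫ θ in (-Real.pi)..Real.pi,
      (dx u (pol r θ) ^ 2 + dy u (pol r θ) ^ 2 - 13/12 * u (pol r θ) ^ 2)) hab
    (fun r hr => (hD1 r hr).continuousAt.continuousWithinAt)
    (fun r hr => (hD1 r (Set.Ioo_subset_Icc_self hr)).hasDerivWithinAt)
    hc.integrableOn_Icc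
    (fun r hr => hD2 r (Set.Ioo_subset_Icc_self hr) (ha.trans_lt hr.1))

open MeasureTheory in
lemma integral_polar {G : E2 → ℝ} {R : ℝ} (hR : 0 ≤ R) (hG : Continuous G)
    (h0 : ∀ x, R ≤ ‖x‖ → G x = 0) :
    ∫ x, G x = ∫ r in (0:ℝ)..R, r * ∫ θ in (-Real.pi)..Real.pi, G (pol r θ) := by
  have e0 : ∫ x : E2, G x = ∫ p : ℝ × ℝ, G !₂[p.1, p.2] := by
    have m1 := (EuclideanSpace.volume_preserving_symm_measurableEquiv_toLp (Fin 2)).symm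
    have m2 := (volume_preserving_finTwoArrow ℝ).symm
    rw [← m1.integral_comp', ← m2.integral_comp']
    congr 1
  have hpc : Continuous (fun p : ℝ × ℝ => p.1 * G (pol p.1 p.2)) :=
    continuous_fst.mul (hG.comp continuous_pol)
  rw [e0, ← integral_comp_polarCoord_symm]
  have e1 : ∀ p : ℝ × ℝ, p.1 • G !₂[(polarCoord.symm p).1, (polarCoord.symm p).2] =
      p.1 * G (pol p.1 p.2) := by intro p; rfl
  simp only [e1]
  have e2 : (∫ p in polarCoord.target, p.1 * G (pol p.1 p.2)) =
      ∫ p in Set.Ioc 0 R ×ˢ Set.Ioc (-Real.pi) Real.pi, p.1 * G (pol p.1 p.2) := by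
    have e3 : (∫ p in polarCoord.target, p.1 * G (pol p.1 p.2)) =
      ∫ p in Set.Ioc 0 R ×ˢ Set.Ioo (-Real.pi) Real.pi, p.1 * G (pol p.1 p.2) := by
      rw [polarCoord_target]
      refine setIntegral_eq_of_subset_of_forall_sdiff_eq_zero (by measurability)
        (Set.prod_mono Set.Ioc_subset_Ioi_self subset_rfl) ?_
      rintro ⟨r, θ⟩ ⟨h1, h2⟩
      simp only [Set.mem_prod, Set.mem_Ioi, Set.mem_Ioc, Set.mem_Ioo] at h1 h2
      have : R ≤ ‖pol r θ‖ := by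
        rw [pol_norm, abs_of_pos h1.1]
        by_contra h
        exact h2 ⟨⟨h1.1, by linarith⟩, h1.2⟩
      simp [h0 _ this]
    rw [e3]
    refine setIntegral_congr_set ?_
    refine Measure.set_prod_ae_eq (Filter.EventuallyEq.rfl) Ioo_ae_eq_Ioc
  rw [e2, intervalIntegral.integral_of_le hR]
  have : IntegrableOn (fun p : ℝ × ℝ => p.1 * G (pol p.1 p.2)) (Set.Ioc 0 R ×ˢ Set.Ioc (-Real.pi) Real.pi) :=
    ((hpc.continuousOn).integrableOn_compact (isCompact_Icc.prod isCompact_Icc)).mono_set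
      (Set.prod_mono Set.Ioc_subset_Icc_self Set.Ioc_subset_Icc_self)
  rw [Measure.volume_eq_prod] at this ⊢
  rw [setIntegral_prod _ this]
  congr 1; ext r
  rw [intervalIntegral.integral_of_le (by linarith [Real.pi_pos]), MeasureTheory.integral_const_mul]

open MeasureTheory in
lemma energy_lower {u : E2 → ℝ} (hu : ContDiff ℝ 1 u) {R : ℝ} (hR : 19/10 < R) (hR2 : R ^ 2 ≤ 12)
    (h0 : ∀ x, R ≤ ‖x‖ → u x = 0) (hm : mean u (19/10) = 0) :
    0 ≤ ∫ x, (dx u x ^ 2 + dy u x ^ 2 - 13/12 * u x ^ 2) := by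
  have hd : Differentiable ℝ u := hu.differentiable (by norm_num)
  have hcu : Continuous u := hd.continuous
  have hcf := hu.continuous_fderiv (by norm_num)
  have hcx : Continuous (dx u) := hcf.clm_apply continuous_const
  have hcy : Continuous (dy u) := hcf.clm_apply continuous_const
  have hf0 : ∀ x, R ≤ ‖x‖ → fderiv ℝ u x = 0 := by
    have h1 : ∀ x : E2, R < ‖x‖ → fderiv ℝ u x = 0 := by
      intro x hx
      have : u =ᶠ[nhds x] fun _ => 0 := by
        filter_upwards [(continuous_norm.tendsto x).eventually (lt_mem_nhds hx)] with y hy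
        exact h0 y (le_of_lt hy)
      rw [this.fderiv_eq]; simp
    intro x hx
    have hx0 : 0 < ‖x‖ := by linarith
    have hcl : IsClosed {t : ℝ | fderiv ℝ u (t • x) = 0} :=
      isClosed_eq (hcf.comp (by fun_prop)) continuous_const
    have : (1:ℝ) ∈ closure (Set.Ioi (1:ℝ)) := by rw [closure_Ioi]; simp
    have h2 := hcl.closure_subset_iff.2 (fun t (ht : t ∈ Set.Ioi (1:ℝ)) => h1 _ (by
      rw [norm_smul, Real.norm_of_nonneg (by linarith [Set.mem_Ioi.1 ht])]
      nlinarith [Set.mem_Ioi.1 ht])) this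
    simpa using h2
  rw [integral_polar (by linarith : 0 ≤ R) (by fun_prop) (fun x hx => by
    simp [dx, dy, hf0 x hx, h0 x hx])]
  have s1 := radial_step hu (a := 0) (b := 19/10) le_rfl (by norm_num) (by norm_num) _
    (fun r hr => H0_spec hr.1 hr.2)
  have s2 := radial_step hu (a := 19/10) (b := R) (by norm_num) hR.le hR2 _
    (fun r hr => H2_spec hr.1 (by nlinarith [hr.1, hr.2]))
  have hc : Continuous (fun r => r * ∫ θ in (-Real.pi)..Real.pi,
      (dx u (pol r θ) ^ 2 + dy u (pol r θ) ^ 2 - 13/12 * u (pol r θ) ^ 2)) := by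
    refine continuous_id.mul ?_
    have cU : Continuous (fun p : ℝ × ℝ => u (pol p.1 p.2)) := hcu.comp continuous_pol
    have cX : Continuous (fun p : ℝ × ℝ => dx u (pol p.1 p.2)) := hcx.comp continuous_pol
    have cY : Continuous (fun p : ℝ × ℝ => dy u (pol p.1 p.2)) := hcy.comp continuous_pol
    exact intervalIntegral.continuous_parametric_intervalIntegral_of_continuous' (by
      simp only [Function.uncurry_def]; fun_prop) _ _
  rw [← intervalIntegral.integral_add_adjacent_intervals (b := 19/10) (hc.intervalIntegrable _ _) (hc.intervalIntegrable _ _)]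
  have hp0 : ∀ θ, pol 0 θ = 0 := by
    intro θ; ext i; fin_cases i <;> simp [pol]
  have hpR : ∀ θ, u (pol R θ) = 0 := fun θ => h0 _ (by rw [pol_norm]; exact le_abs_self R)
  have z0 : ∀ H, H 0 = 0 → Psi u H 0 = 0 := by
    intro H hH
    simp only [Psi, hp0, mean, hH, intervalIntegral.integral_const, smul_eq_mul]
    have := Real.pi_pos
    field_simp
    ring
  have zR : ∀ H, Psi u H R = 0 := by
    intro H
    simp [Psi, hpR, mean]
  have e1 : ∀ H K, Psi u H (19/10) = Psi u K (19/10) := by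
    intro H K
    simp [Psi, hm]
  rw [z0 _ (by norm_num)] at s1
  rw [zR, e1 _ (fun r : ℝ => (-(13/24) * r ^ 2) / (1 - 13/48 * r ^ 2))] at s2
  linarith

/-- A bounded open set on which `F` is positive, with `F = 0` on the boundary. -/
structure PosDom (F : E2 → ℝ) (V : Set E2) (R : ℝ) : Prop where
  op : IsOpen V
  pos : ∀ x ∈ V, 0 < F x
  fr : ∀ x ∈ closure V, x ∉ V → F x = 0
  sub : V ⊆ ball 0 R

noncomputable def uu (F : E2 → ℝ) (V : Set E2) (ε : ℝ) : E2 → ℝ :=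
  V.indicator fun x => F x ^ 2 / (|F x| + ε)

noncomputable def uu' (F : E2 → ℝ) (V : Set E2) (ε : ℝ) : E2 → (E2 →L[ℝ] ℝ) :=
  V.indicator fun x => (1 - ε ^ 2 / (|F x| + ε) ^ 2) • fderiv ℝ F x

lemma uu_hasFDerivAt {F : E2 → ℝ} (hd : Differentiable ℝ F) {V : Set E2} {R : ℝ} (h : PosDom F V R)
    {ε : ℝ} (hε : 0 < ε) (x : E2) : HasFDerivAt (uu F V ε) (uu' F V ε x) x := by
  by_cases hx : x ∈ V
  · have hpos := h.pos x hx
    have h1 : HasDerivAt (fun t : ℝ => t ^ 2 / (t + ε)) (1 - ε ^ 2 / (F x + ε) ^ 2) (F x) := by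
      have hne : F x + ε ≠ 0 := by positivity
      refine ((hasDerivAt_pow 2 (F x)).div ((hasDerivAt_id (F x)).add_const ε) hne).congr_deriv ?_
      simp only [id]
      field_simp
      ring
    have h2 := h1.comp_hasFDerivAt x (hd x).hasFDerivAt
    have h3 : uu' F V ε x = (1 - ε ^ 2 / (F x + ε) ^ 2) • fderiv ℝ F x := by
      simp only [uu', Set.indicator_of_mem hx, abs_of_pos hpos]
    rw [h3]
    refine h2.congr_of_eventuallyEq ?_
    filter_upwards [h.op.mem_nhds hx] with y hy
    simp only [uu, Set.indicator_of_mem hy, abs_of_pos (h.pos y hy), Function.comp]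
  · have h3 : uu' F V ε x = 0 := by simp [uu', hx]
    rw [h3]
    by_cases hxc : x ∈ closure V
    · have hFx := h.fr x hxc hx
      have h4 : HasFDerivAt (fun y => F y ^ 2) (0 : E2 →L[ℝ] ℝ) x := by
        refine ((hd x).hasFDerivAt.pow 2).congr_fderiv ?_
        simp [hFx]
      rw [hasFDerivAt_iff_isLittleO] at h4 ⊢
      simp only [hFx, ContinuousLinearMap.zero_apply, sub_zero, uu, Set.indicator_of_notMem hx] at h4 ⊢
      norm_num at h4
      refine Asymptotics.IsBigO.trans_isLittleO (Asymptotics.IsBigO.of_bound (1/ε) ?_) h4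
      filter_upwards with y
      by_cases hy : y ∈ V
      · rw [Set.indicator_of_mem hy, Real.norm_of_nonneg (by positivity), Real.norm_of_nonneg (by positivity)]
        rw [div_mul_eq_mul_div, one_mul]
        exact div_le_div_of_nonneg_left (by positivity) hε (by linarith [abs_nonneg (F y)])
      · rw [Set.indicator_of_notMem hy]; simp; positivity
    · have : uu F V ε =ᶠ[nhds x] fun _ => 0 := by
        filter_upwards [isClosed_closure.isOpen_compl.mem_nhds hxc] with y hy
        exact Set.indicator_of_notMem (fun hyV => hy (subset_closure hyV)) _
      exact (hasFDerivAt_const (0:ℝ) x).congr_of_eventuallyEq this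

lemma uu'_continuous {F : E2 → ℝ} (hd : ContDiff ℝ 1 F) {V : Set E2} {R : ℝ} (h : PosDom F V R)
    {ε : ℝ} (hε : 0 < ε) : Continuous (uu' F V ε) := by
  refine continuous_indicator ?_ (Continuous.continuousOn ?_)
  · intro a ha
    have := h.fr a ha.1 (by rw [h.op.frontier_eq] at ha; exact ha.2)
    simp [this, hε.ne']
  · have h1 := hd.continuous_fderiv (by norm_num)
    have h2 := hd.continuous
    have h3 : Continuous fun x => 1 - ε ^ 2 / (|F x| + ε) ^ 2 := by
      refine continuous_const.sub (continuous_const.div (by fun_prop) (fun x => ?_))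
      positivity
    exact h3.smul h1

lemma uu_contDiff {F : E2 → ℝ} (hd : ContDiff ℝ 1 F) {V : Set E2} {R : ℝ} (h : PosDom F V R)
    {ε : ℝ} (hε : 0 < ε) : ContDiff ℝ 1 (uu F V ε) :=
  contDiff_one_iff_hasFDerivAt.2 ⟨uu' F V ε, uu'_continuous hd h hε,
    uu_hasFDerivAt (hd.differentiable (by norm_num)) h hε⟩

open MeasureTheory in
lemma integrable_of_zero_out {G : E2 → ℝ} (hG : Continuous G) {V : Set E2} {R : ℝ} (hV : V ⊆ ball 0 R)
    (h0 : ∀ x, x ∉ V → G x = 0) : Integrable G := by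
  refine hG.integrable_of_hasCompactSupport (HasCompactSupport.intro (isCompact_closedBall (0:E2) R) ?_)
  intro x hx
  exact h0 x fun h => hx (ball_subset_closedBall (hV h))

noncomputable def en (u : E2 → ℝ) (x : E2) : ℝ := dx u x ^ 2 + dy u x ^ 2 - 13/12 * u x ^ 2

lemma en_continuous {u : E2 → ℝ} (hu : ContDiff ℝ 1 u) : Continuous (en u) := by
  have hcf := hu.continuous_fderiv (by norm_num)
  have hcx : Continuous (dx u) := hcf.clm_apply continuous_const
  have hcy : Continuous (dy u) := hcf.clm_apply continuous_const
  have := hu.continuous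
  unfold en
  fun_prop

open MeasureTheory in
lemma energy_upper {F : E2 → ℝ} (hF : ContDiff ℝ (⊤ : ℕ∞) F) (hE : ∀ x, laplacian F x + F x = 0)
    {V : Set E2} {R : ℝ} (h : PosDom F V R) (hne : V.Nonempty) :
    ∃ ε₀ > 0, ∀ ε, 0 < ε → ε < ε₀ → ∫ x, en (uu F V ε) x < 0 := by
  have hF1 : ContDiff ℝ 1 F := hF.of_le (by norm_cast)
  have hFc := hF.continuous
  have hVm := h.op.measurableSet
  have hfr : ∀ a ∈ frontier V, F a = 0 := fun a ha =>
    h.fr a ha.1 (by rw [h.op.frontier_eq] at ha; exact ha.2)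
  have cI1 : Continuous (V.indicator F) := continuous_indicator hfr hFc.continuousOn
  have cI2 : Continuous (V.indicator fun x => F x ^ 2) :=
    continuous_indicator (fun a ha => by simp [hfr a ha]) (by fun_prop)
  have i1 : Integrable (V.indicator F) :=
    integrable_of_zero_out cI1 h.sub (fun x hx => Set.indicator_of_notMem hx _)
  have i2 : Integrable (V.indicator fun x => F x ^ 2) :=
    integrable_of_zero_out cI2 h.sub (fun x hx => Set.indicator_of_notMem hx _)
  have I1 : 0 ≤ ∫ x, V.indicator F x :=
    integral_nonneg (fun x => Set.indicator_nonneg (fun x hx => (h.pos x hx).le) x)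
  have I2 : 0 < ∫ x, V.indicator (fun x => F x ^ 2) x := by
    rw [integral_pos_iff_support_of_nonneg (fun x => Set.indicator_nonneg (fun x hx => sq_nonneg _) x) i2]
    have : V ⊆ Function.support (V.indicator fun x => F x ^ 2) := by
      intro x hx
      rw [Function.mem_support, Set.indicator_of_mem hx]
      exact (pow_pos (h.pos x hx) 2).ne'
    exact (h.op.measure_pos _ hne).trans_le (measure_mono this)
  set J1 := ∫ x, V.indicator F x
  set J2 := ∫ x, V.indicator (fun x => F x ^ 2) x
  refine ⟨(J2 / 12) / (13/6 * (J1 + 1)), by positivity, ?_⟩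
  intro ε hε hε'
  rw [lt_div_iff₀ (by positivity)] at hε'
  set u := uu F V ε with hu
  have hu1 : ContDiff ℝ 1 u := uu_contDiff hF1 h hε
  have hfd : ∀ x, fderiv ℝ u x = uu' F V ε x := fun x =>
    (uu_hasFDerivAt (hF1.differentiable (by norm_num)) h hε x).fderiv
  have cu := hu1.continuous
  have u0 : ∀ x, x ∉ V → u x = 0 := fun x hx => Set.indicator_of_notMem hx _
  have ux0 : ∀ x, x ∉ V → dx u x = 0 := fun x hx => by simp [dx, hfd, uu', hx]
  have uy0 : ∀ x, x ∉ V → dy u x = 0 := fun x hx => by simp [dy, hfd, uu', hx]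
  have hcf := hu1.continuous_fderiv (by norm_num)
  have cux : Continuous (dx u) := hcf.clm_apply continuous_const
  have cuy : Continuous (dy u) := hcf.clm_apply continuous_const
  have hdx := contDiff_dx hF
  have hdy := contDiff_dy hF
  have hdxx := contDiff_dx hdx
  have hdyy := contDiff_dy hdy
  have cFx := hdx.continuous
  have cFy := hdy.continuous
  have cFxx := hdxx.continuous
  have cFyy := hdyy.continuous
  have hne' : ((⊤ : ℕ∞) : WithTop ℕ∞) ≠ 0 := by simp
  have jx1 : Integrable fun x => dx u x * dx F x :=
    integrable_of_zero_out (by fun_prop) h.sub (fun x hx => by simp [ux0 x hx])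
  have jx2 : Integrable fun x => u x * dx (dx F) x :=
    integrable_of_zero_out (by fun_prop) h.sub (fun x hx => by simp [u0 x hx])
  have jx3 : Integrable fun x => u x * dx F x :=
    integrable_of_zero_out (by fun_prop) h.sub (fun x hx => by simp [u0 x hx])
  have jy1 : Integrable fun x => dy u x * dy F x :=
    integrable_of_zero_out (by fun_prop) h.sub (fun x hx => by simp [uy0 x hx])
  have jy2 : Integrable fun x => u x * dy (dy F) x :=
    integrable_of_zero_out (by fun_prop) h.sub (fun x hx => by simp [u0 x hx])
  have jy3 : Integrable fun x => u x * dy F x :=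
    integrable_of_zero_out (by fun_prop) h.sub (fun x hx => by simp [u0 x hx])
  have jF : Integrable fun x => u x * F x :=
    integrable_of_zero_out (by fun_prop) h.sub (fun x hx => by simp [u0 x hx])
  have ju : Integrable fun x => u x ^ 2 :=
    integrable_of_zero_out (by fun_prop) h.sub (fun x hx => by simp [u0 x hx])
  have je : Integrable (en u) :=
    integrable_of_zero_out (en_continuous hu1) h.sub (fun x hx => by
      simp [en, u0 x hx, ux0 x hx, uy0 x hx])
  have gx : ∫ x, u x * dx (dx F) x = - ∫ x, dx u x * dx F x :=
    integral_mul_fderiv_eq_neg_fderiv_mul_of_integrable (f := u) (g := dx F) jx1 jx2 jx3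
      (fun x _ => hu1.differentiable (by norm_num) x) (fun x _ => hdx.differentiable hne' x)
  have gy : ∫ x, u x * dy (dy F) x = - ∫ x, dy u x * dy F x :=
    integral_mul_fderiv_eq_neg_fderiv_mul_of_integrable (f := u) (g := dy F) jy1 jy2 jy3
      (fun x _ => hu1.differentiable (by norm_num) x) (fun x _ => hdy.differentiable hne' x)
  have g : ∫ x, (dx u x * dx F x + dy u x * dy F x) = ∫ x, u x * F x := by
    rw [integral_add jx1 jy1]
    have e : ∀ x, u x * F x = - (u x * dx (dx F) x + u x * dy (dy F) x) := by
      intro x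
      have := hE x
      rw [laplacian_eq] at this
      linear_combination u x * this
    simp only [e]
    rw [MeasureTheory.integral_neg, integral_add jx2 jy2, gx, gy]
    ring
  have b1 : ∫ x, en u x ≤ ∫ x, ((dx u x * dx F x + dy u x * dy F x) - 13/12 * u x ^ 2) := by
    refine integral_mono je ((jx1.add jy1).sub (ju.const_mul _)) ?_
    intro x
    simp only [en]
    have key : ∀ a b : ℝ, (a = 0 ∨ ∃ t, 0 ≤ t ∧ t ≤ 1 ∧ a = t * b) → a ^ 2 ≤ a * b := by
      rintro a b (h | ⟨t, h1, h2, rfl⟩)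
      · simp [h]
      · nlinarith [mul_nonneg (mul_nonneg h1 (sub_nonneg.2 h2)) (sq_nonneg b)]
    have ht : 0 ≤ 1 - ε ^ 2 / (|F x| + ε) ^ 2 ∧ 1 - ε ^ 2 / (|F x| + ε) ^ 2 ≤ 1 := by
      constructor
      · rw [sub_nonneg]
        exact div_le_one_of_le₀ (by gcongr; linarith [abs_nonneg (F x)]) (by positivity)
      · have : 0 ≤ ε ^ 2 / (|F x| + ε) ^ 2 := by positivity
        linarith
    have k1 := key (dx u x) (dx F x) (by
      by_cases hx : x ∈ V
      · right
        refine ⟨_, ht.1, ht.2, ?_⟩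
        simp only [dx, hfd, uu', Set.indicator_of_mem hx]; rfl
      · left; exact ux0 x hx)
    have k2 := key (dy u x) (dy F x) (by
      by_cases hx : x ∈ V
      · right
        refine ⟨_, ht.1, ht.2, ?_⟩
        simp only [dy, hfd, uu', Set.indicator_of_mem hx]; rfl
      · left; exact uy0 x hx)
    linarith
  have b2 : ∫ x, ((dx u x * dx F x + dy u x * dy F x) - 13/12 * u x ^ 2) =
      ∫ x, (u x * F x - 13/12 * u x ^ 2) := by
    rw [MeasureTheory.integral_sub (f := fun x => dx u x * dx F x + dy u x * dy F x) (jx1.add jy1) (ju.const_mul _), MeasureTheory.integral_sub jF (ju.const_mul _), g]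
  have b3 : ∫ x, (u x * F x - 13/12 * u x ^ 2) ≤
      ∫ x, (13/6 * ε * V.indicator F x - 1/12 * V.indicator (fun x => F x ^ 2) x) := by
    refine integral_mono (jF.sub (ju.const_mul _)) ((i1.const_mul _).sub (i2.const_mul _)) ?_
    intro x
    by_cases hx : x ∈ V
    · have hp := h.pos x hx
      have hux : u x = F x ^ 2 / (F x + ε) := by
        simp only [hu, uu, Set.indicator_of_mem hx, abs_of_pos hp]
      simp only [Set.indicator_of_mem hx]
      have l1 : u x ≤ F x := by
        rw [hux, div_le_iff₀ (by positivity)]; nlinarith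
      have l2 : F x - ε ≤ u x := by
        rw [hux, le_div_iff₀ (by positivity)]; nlinarith
      have l0 : 0 ≤ u x := by rw [hux]; positivity
      have l3 : F x ^ 2 - 2 * ε * F x ≤ u x ^ 2 := by
        rcases le_total (F x) ε with h | h
        · nlinarith
        · nlinarith
      nlinarith
    · simp [u0 x hx, hx]
  rw [MeasureTheory.integral_sub (i1.const_mul _) (i2.const_mul _), MeasureTheory.integral_const_mul,
    MeasureTheory.integral_const_mul] at b3
  change _ ≤ 13/6 * ε * J1 - 1/12 * J2 at b3
  nlinarith

open MeasureTheory in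
lemma two_domains {F : E2 → ℝ} (hF : ContDiff ℝ (⊤ : ℕ∞) F) (hE : ∀ x, laplacian F x + F x = 0)
    {V W : Set E2} {R : ℝ} (hV : PosDom F V R) (hW : PosDom F W R) (nV : V.Nonempty) (nW : W.Nonempty)
    (hVW : Disjoint V W) (hR : 19/10 < R) (hR2 : R ^ 2 ≤ 12) : False := by
  have hF1 : ContDiff ℝ 1 F := hF.of_le (by norm_cast)
  obtain ⟨e1, he1, h1⟩ := energy_upper hF hE hV nV
  obtain ⟨e2, he2, h2⟩ := energy_upper hF hE hW nW
  obtain ⟨ε, hε, hε'⟩ := exists_between (lt_min he1 he2)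
  specialize h1 ε hε (hε'.trans_le (min_le_left _ _))
  specialize h2 ε hε (hε'.trans_le (min_le_right _ _))
  set v := uu F V ε with hv
  set w := uu F W ε with hw
  have cv : ContDiff ℝ 1 v := uu_contDiff hF1 hV hε
  have cw : ContDiff ℝ 1 w := uu_contDiff hF1 hW hε
  have dv := cv.differentiable (by norm_num)
  have dw := cw.differentiable (by norm_num)
  have hdF := hF1.differentiable (by norm_num)
  have v0 : ∀ x, x ∉ V → v x = 0 ∧ fderiv ℝ v x = 0 := fun x hx =>
    ⟨Set.indicator_of_notMem hx _, by
      rw [(uu_hasFDerivAt hdF hV hε x).fderiv]; exact Set.indicator_of_notMem hx _⟩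
  have w0 : ∀ x, x ∉ W → w x = 0 ∧ fderiv ℝ w x = 0 := fun x hx =>
    ⟨Set.indicator_of_notMem hx _, by
      rw [(uu_hasFDerivAt hdF hW hε x).fderiv]; exact Set.indicator_of_notMem hx _⟩
  have gen : ∀ a b : ℝ, a * mean v (19/10) + b * mean w (19/10) = 0 → a = 0 ∧ b = 0 := by
    intro a b hab
    have cu : ContDiff ℝ 1 (fun x => a * v x + b * w x) :=
      (contDiff_const.mul cv).add (contDiff_const.mul cw)
    have hm : mean (fun x => a * v x + b * w x) (19/10) = 0 := by
      rw [← hab]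
      have c1 := cv.continuous
      have c2 := cw.continuous
      simp only [mean]
      rw [intervalIntegral.integral_add (Continuous.intervalIntegrable (by fun_prop) _ _)
        (Continuous.intervalIntegrable (by fun_prop) _ _), intervalIntegral.integral_const_mul,
        intervalIntegral.integral_const_mul]
    have lo := energy_lower cu hR hR2 (fun x hx => by
      have hxV : x ∉ V := fun h => by have := hV.sub h; simp at this; linarith
      have hxW : x ∉ W := fun h => by have := hW.sub h; simp at this; linarith
      simp [(v0 x hxV).1, (w0 x hxW).1]) hm
    have hfd : ∀ x, fderiv ℝ (fun x => a * v x + b * w x) x = a • fderiv ℝ v x + b • fderiv ℝ w x :=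
      fun x => (((dv x).hasFDerivAt.const_mul a).add ((dw x).hasFDerivAt.const_mul b)).fderiv
    have pt : ∀ x, (dx (fun x => a * v x + b * w x) x ^ 2 + dy (fun x => a * v x + b * w x) x ^ 2
        - 13/12 * (a * v x + b * w x) ^ 2) = a ^ 2 * en v x + b ^ 2 * en w x := by
      intro x
      simp only [dx, dy, hfd, en, ContinuousLinearMap.add_apply, ContinuousLinearMap.smul_apply, smul_eq_mul]
      by_cases hx : x ∈ V
      · have := w0 x (Set.disjoint_left.1 hVW hx)
        simp only [this.1, this.2, ContinuousLinearMap.zero_apply]; ring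
      · have := v0 x hx
        simp only [this.1, this.2, ContinuousLinearMap.zero_apply]; ring
    simp only [pt] at lo
    have iv : Integrable (en v) := integrable_of_zero_out (en_continuous cv) hV.sub (fun x hx => by
      simp [en, dx, dy, v0 x hx])
    have iw : Integrable (en w) := integrable_of_zero_out (en_continuous cw) hW.sub (fun x hx => by
      simp [en, dx, dy, w0 x hx])
    rw [MeasureTheory.integral_add (iv.const_mul _) (iw.const_mul _), MeasureTheory.integral_const_mul,
      MeasureTheory.integral_const_mul] at lo
    constructor
    · by_contra hne
      have : 0 < a ^ 2 := by positivity
      nlinarith [sq_nonneg b]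
    · by_contra hne
      have : 0 < b ^ 2 := by positivity
      nlinarith [sq_nonneg a]
  have g1 := gen (mean w (19/10)) (- mean v (19/10)) (by ring)
  have g2 := gen 1 0 (by linarith [g1.2])
  exact one_ne_zero g2.1

lemma second_nonneg {G : E2 → ℝ} (hG : ContDiff ℝ (⊤ : ℕ∞) G) {x : E2} (hx : IsLocalMin G x) (e : E2) :
    0 ≤ fderiv ℝ (fun y => fderiv ℝ G y e) x e := by
  have hne : ((⊤ : ℕ∞) : WithTop ℕ∞) ≠ 0 := by simp
  have hd := hG.differentiable hne
  have hG2 : ContDiff ℝ (⊤ : ℕ∞) (fun y => fderiv ℝ G y e) :=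
    (hG.fderiv_right (m := (⊤ : ℕ∞)) (by simp)).clm_apply contDiff_const
  have hd2 := hG2.differentiable hne
  have hl : ∀ t : ℝ, HasDerivAt (fun t : ℝ => x + t • e) e t := fun t => by
    simpa using ((hasDerivAt_id t).smul_const e).const_add x
  let g : ℝ → ℝ := fun t => G (x + t • e)
  have g1 : ∀ t, HasDerivAt g (fderiv ℝ G (x + t • e) e) t := fun t =>
    (hd _).hasFDerivAt.comp_hasDerivAt t (hl t)
  have g2 : ∀ t, HasDerivAt (fun t : ℝ => fderiv ℝ G (x + t • e) e)
      (fderiv ℝ (fun y => fderiv ℝ G y e) (x + t • e) e) t := fun t =>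
    HasFDerivAt.comp_hasDerivAt (l := fun y => fderiv ℝ G y e) t (hd2 (x + t • e)).hasFDerivAt (hl t)
  have d1 : deriv g = fun t => fderiv ℝ G (x + t • e) e := funext fun t => (g1 t).deriv
  have d2 : deriv (deriv g) 0 = fderiv ℝ (fun y => fderiv ℝ G y e) x e := by
    rw [d1, (g2 0).deriv]; simp
  have gmin : IsLocalMin g 0 := by
    have : Filter.Tendsto (fun t : ℝ => x + t • e) (nhds 0) (nhds x) := by
      have := (hl 0).continuousAt.tendsto
      simpa using this
    have h := this.eventually hx
    filter_upwards [h] with t ht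
    simpa [g] using ht
  by_contra hneg
  push Not at hneg
  rw [← d2] at hneg
  have gmax := isLocalMax_of_deriv_deriv_neg hneg gmin.deriv_eq_zero (g1 0).continuousAt
  have hc : g =ᶠ[nhds 0] fun _ => g 0 := by
    filter_upwards [gmin, gmax] with t h1 h2
    exact le_antisymm h2 h1
  have h3 := hc.deriv.deriv_eq
  simp at h3
  linarith

lemma laplacian_nonneg {G : E2 → ℝ} (hG : ContDiff ℝ (⊤ : ℕ∞) G) {x : E2} (hx : IsLocalMin G x) :
    0 ≤ laplacian G x :=
  Finset.sum_nonneg fun i _ => second_nonneg hG hx _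

noncomputable def bar (c : ℝ) (x : E2) : ℝ := 10 - (x 0 ^ 2 + x 1 ^ 2 - c) ^ 2

lemma bar_contDiff (c : ℝ) : ContDiff ℝ (⊤ : ℕ∞) (bar c) := by unfold bar; fun_prop

lemma fderiv_line {f : E2 → ℝ} (hf : Differentiable ℝ f) {x e : E2} {d : ℝ}
    (h : HasDerivAt (fun t : ℝ => f (x + t • e)) d 0) : fderiv ℝ f x e = d := by
  rw [← (hf x).lineDeriv_eq_fderiv]; exact h.deriv

lemma bar_laplacian (c : ℝ) (x : E2) :
    laplacian (bar c) x = - 16 * (x 0 ^ 2 + x 1 ^ 2) + 8 * c := by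
  have hne : ((⊤ : ℕ∞) : WithTop ℕ∞) ≠ 0 := by simp
  have hb := (bar_contDiff c).differentiable hne
  have h0 : dx (bar c) = fun x => - 4 * x 0 * (x 0 ^ 2 + x 1 ^ 2 - c) := by
    funext x
    refine fderiv_line hb ?_
    have : HasDerivAt (fun t : ℝ => 10 - ((x 0 + t) ^ 2 + x 1 ^ 2 - c) ^ 2)
        (- 4 * x 0 * (x 0 ^ 2 + x 1 ^ 2 - c)) 0 := by
      refine (((((((hasDerivAt_id (0:ℝ)).const_add (x 0)).pow 2).add_const (x 1 ^ 2)).sub_const c).pow 2).const_sub 10).congr_deriv ?_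
      simp; ring
    simpa [bar] using this
  have h1 : dy (bar c) = fun x => - 4 * x 1 * (x 0 ^ 2 + x 1 ^ 2 - c) := by
    funext x
    refine fderiv_line hb ?_
    have : HasDerivAt (fun t : ℝ => 10 - (x 0 ^ 2 + (x 1 + t) ^ 2 - c) ^ 2)
        (- 4 * x 1 * (x 0 ^ 2 + x 1 ^ 2 - c)) 0 := by
      refine (((((((hasDerivAt_id (0:ℝ)).const_add (x 1)).pow 2).const_add (x 0 ^ 2)).sub_const c).pow 2).const_sub 10).congr_deriv ?_
      simp; ring
    simpa [bar] using this
  have h00 : dx (dx (bar c)) x = - 4 * (x 0 ^ 2 + x 1 ^ 2 - c) - 8 * x 0 ^ 2 := by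
    refine fderiv_line ((contDiff_dx (bar_contDiff c)).differentiable hne) ?_
    rw [h0]
    have : HasDerivAt (fun t : ℝ => - 4 * (x 0 + t) * ((x 0 + t) ^ 2 + x 1 ^ 2 - c))
        (- 4 * (x 0 ^ 2 + x 1 ^ 2 - c) - 8 * x 0 ^ 2) 0 := by
      refine ((((hasDerivAt_id (0:ℝ)).const_add (x 0)).const_mul (-4)).mul (((((hasDerivAt_id (0:ℝ)).const_add (x 0)).pow 2).add_const (x 1 ^ 2)).sub_const c)).congr_deriv ?_
      simp; ring
    simpa using this
  have h11 : dy (dy (bar c)) x = - 4 * (x 0 ^ 2 + x 1 ^ 2 - c) - 8 * x 1 ^ 2 := by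
    refine fderiv_line ((contDiff_dy (bar_contDiff c)).differentiable hne) ?_
    rw [h1]
    have : HasDerivAt (fun t : ℝ => - 4 * (x 1 + t) * (x 0 ^ 2 + (x 1 + t) ^ 2 - c))
        (- 4 * (x 0 ^ 2 + x 1 ^ 2 - c) - 8 * x 1 ^ 2) 0 := by
      refine ((((hasDerivAt_id (0:ℝ)).const_add (x 1)).const_mul (-4)).mul (((((hasDerivAt_id (0:ℝ)).const_add (x 1)).pow 2).const_add (x 0 ^ 2)).sub_const c)).congr_deriv ?_
      simp; ring
    simpa using this
  rw [laplacian_eq, h00, h11]; ring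

lemma fderiv_comb {f g : E2 → ℝ} (hf : Differentiable ℝ f) (hg : Differentiable ℝ g) (l : ℝ) (x e : E2) :
    fderiv ℝ (fun x => l * f x - g x) x e = l * fderiv ℝ f x e - fderiv ℝ g x e := by
  have h : HasFDerivAt (fun x => l * f x - g x) (l • fderiv ℝ f x - fderiv ℝ g x) x :=
    ((hf x).hasFDerivAt.const_mul l).sub (hg x).hasFDerivAt
  rw [h.fderiv]; rfl

lemma annulus {F : E2 → ℝ} (hF : ContDiff ℝ (⊤ : ℕ∞) F) (hE : ∀ x, laplacian F x + F x = 0)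
    {V : Set E2} {R : ℝ} (h : PosDom F V R) (nV : V.Nonempty) {a b : ℝ} (ha : 4 ≤ a) (hb : b - a ≤ 6)
    (hsub : ∀ x ∈ V, a ≤ ‖x‖ ^ 2 ∧ ‖x‖ ^ 2 ≤ b) : False := by
  have hne : ((⊤ : ℕ∞) : WithTop ℕ∞) ≠ 0 := by simp
  set c := a + 3 with hc
  have hnq : ∀ x : E2, ‖x‖ ^ 2 = x 0 ^ 2 + x 1 ^ 2 := fun x => by
    rw [EuclideanSpace.norm_sq_eq]; simp
  have hcl : ∀ x ∈ closure V, a ≤ ‖x‖ ^ 2 ∧ ‖x‖ ^ 2 ≤ b := by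
    have : IsClosed ({x : E2 | a ≤ ‖x‖ ^ 2} ∩ {x : E2 | ‖x‖ ^ 2 ≤ b}) :=
      (isClosed_le (by fun_prop) (by fun_prop)).inter (isClosed_le (by fun_prop) (by fun_prop))
    exact closure_minimal hsub this
  have hw : ∀ x ∈ closure V, 0 < bar c x := by
    intro x hx
    have := hcl x hx
    rw [hnq] at this
    unfold bar
    nlinarith
  have hcomp : IsCompact (closure V) :=
    (isCompact_closedBall (0:E2) R).of_isClosed_subset isClosed_closure
      (closure_minimal (h.sub.trans ball_subset_closedBall) isClosed_closedBall)
  have cF := hF.continuous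
  have cb := (bar_contDiff c).continuous
  obtain ⟨x₀, hx₀, hmax⟩ := hcomp.exists_isMaxOn (f := fun x => F x / bar c x)
    nV.closure (cF.continuousOn.div cb.continuousOn (fun x hx => (hw x hx).ne'))
  obtain ⟨z, hz⟩ := nV
  have hpos : 0 < F x₀ / bar c x₀ :=
    (div_pos (h.pos z hz) (hw z (subset_closure hz))).trans_le (hmax (subset_closure hz))
  have hFx : 0 < F x₀ := by
    have := mul_pos hpos (hw x₀ hx₀)
    rwa [div_mul_cancel₀ _ (hw x₀ hx₀).ne'] at this
  have hxV : x₀ ∈ V := by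
    by_contra hn
    have := h.fr x₀ hx₀ hn
    linarith
  set l := F x₀ / bar c x₀ with hl
  have hFl : F x₀ = l * bar c x₀ := by rw [hl, div_mul_cancel₀ _ (hw x₀ hx₀).ne']
  have hG : ContDiff ℝ (⊤ : ℕ∞) (fun x => l * bar c x - F x) :=
    (contDiff_const.mul (bar_contDiff c)).sub hF
  have hmin : IsLocalMin (fun x => l * bar c x - F x) x₀ := by
    filter_upwards [h.op.mem_nhds hxV] with y hy
    have h1 : F y / bar c y ≤ l := hmax (subset_closure hy)
    rw [div_le_iff₀ (hw y (subset_closure hy))] at h1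
    linarith
  have hlap := laplacian_nonneg hG hmin
  have hbd := (bar_contDiff c).differentiable hne
  have hFd := hF.differentiable hne
  have e0 : dx (fun x => l * bar c x - F x) = fun x => l * dx (bar c) x - dx F x :=
    funext fun x => fderiv_comb hbd hFd l x _
  have e1 : dy (fun x => l * bar c x - F x) = fun x => l * dy (bar c) x - dy F x :=
    funext fun x => fderiv_comb hbd hFd l x _
  have e00 : dx (dx (fun x => l * bar c x - F x)) x₀ = l * dx (dx (bar c)) x₀ - dx (dx F) x₀ := by
    rw [e0]
    exact fderiv_comb ((contDiff_dx (bar_contDiff c)).differentiable hne)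
      ((contDiff_dx hF).differentiable hne) l x₀ _
  have e11 : dy (dy (fun x => l * bar c x - F x)) x₀ = l * dy (dy (bar c)) x₀ - dy (dy F) x₀ := by
    rw [e1]
    exact fderiv_comb ((contDiff_dy (bar_contDiff c)).differentiable hne)
      ((contDiff_dy hF).differentiable hne) l x₀ _
  rw [laplacian_eq, e00, e11] at hlap
  have hb1 := bar_laplacian c x₀
  have hE1 := hE x₀
  rw [laplacian_eq] at hb1 hE1
  have : 0 ≤ l * (dx (dx (bar c)) x₀ + dy (dy (bar c)) x₀ + bar c x₀) := by
    rw [hFl] at hE1; linarith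
  rw [hb1] at this
  have hq := hcl x₀ hx₀
  rw [hnq] at hq
  have neg : -16 * (x₀ 0 ^ 2 + x₀ 1 ^ 2) + 8 * c + bar c x₀ < 0 := by
    unfold bar
    generalize x₀ 0 ^ 2 + x₀ 1 ^ 2 = q at *
    nlinarith [sq_nonneg (q - a)]
  nlinarith [mul_pos_of_neg_of_neg neg (neg_neg_of_pos hpos)]

lemma rank_E2 : 1 < Module.rank ℝ E2 := by
  rw [← Module.finrank_eq_rank]; simp

lemma cross {S : Set E2} (hS : IsPreconnected S) {y z : E2} (hy : y ∈ S) (hz : z ∈ S) {ρ : ℝ}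
    (h1 : ‖y‖ ≤ ρ) (h2 : ρ ≤ ‖z‖) : ∃ w ∈ S, ‖w‖ = ρ := by
  obtain ⟨w, hw, h⟩ := hS.intermediate_value hy hz continuous_norm.continuousOn ⟨h1, h2⟩
  exact ⟨w, hw, h⟩

lemma pre_sign {F : E2 → ℝ} (hF : Continuous F) {S : Set E2} (hS : IsPreconnected S)
    (h0 : ∀ x ∈ S, F x ≠ 0) {y z : E2} (hy : y ∈ S) (hz : z ∈ S) (h : 0 < F y) : 0 < F z := by
  by_contra hn
  push Not at hn
  obtain ⟨w, hw, h1⟩ := hS.intermediate_value hz hy hF.continuousOn ⟨hn, h.le⟩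
  exact h0 w hw h1

lemma pre_sign_neg {F : E2 → ℝ} (hF : Continuous F) {S : Set E2} (hS : IsPreconnected S)
    (h0 : ∀ x ∈ S, F x ≠ 0) {y z : E2} (hy : y ∈ S) (hz : z ∈ S) (h : F y < 0) : F z < 0 := by
  have := pre_sign hF.neg hS (fun x hx => neg_ne_zero.2 (h0 x hx)) hy hz (by simpa using h)
  simpa using this

lemma posDom_nodal {F : E2 → ℝ} (hF : Continuous F) {x : E2} (hx : 0 < F x) {R : ℝ}
    (hsub : connectedComponentIn {x | F x ≠ 0} x ⊆ ball 0 R) :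
    PosDom F (connectedComponentIn {x | F x ≠ 0} x) R := by
  have hop : IsOpen {x | F x ≠ 0} := isOpen_ne_fun hF continuous_const
  refine ⟨hop.connectedComponentIn, ?_, ?_, hsub⟩
  · intro y hy
    exact pre_sign hF isPreconnected_connectedComponentIn
      (fun z hz => connectedComponentIn_subset _ _ hz) (mem_connectedComponentIn hx.ne') hy hx
  · intro y hy hn
    by_contra hFy
    obtain ⟨w, hw1, hw2⟩ := mem_closure_iff.1 hy _ (hop.connectedComponentIn (x := y))
      (mem_connectedComponentIn hFy)
    apply hn
    rw [connectedComponentIn_eq hw2, ← connectedComponentIn_eq hw1]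
    exact mem_connectedComponentIn hFy

lemma seg_pre (p e : E2) (a b : ℝ) : IsPreconnected ((fun t : ℝ => p + t • e) '' Set.Icc a b) :=
  isPreconnected_Icc.image _ (by fun_prop)

lemma reach_closure {D : Set E2} (hD : IsOpen D) {y d : E2} (hy : y ∈ Dᶜ) (hd : d ∈ D) :
    ∃ p ∈ connectedComponentIn Dᶜ y, p ∈ closure D := by
  set γ : ℝ → E2 := fun t => y + t • (d - y) with hγ
  have hγc : Continuous γ := by fun_prop
  set S : Set ℝ := {t | 0 ≤ t ∧ γ t ∈ D} with hS
  have h1 : (1:ℝ) ∈ S := ⟨by norm_num, by simpa [hγ] using hd⟩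
  have hbdd : BddBelow S := ⟨0, fun t ht => ht.1⟩
  set t₀ := sInf S with ht₀
  have h0 : 0 ≤ t₀ := le_csInf ⟨1, h1⟩ fun t ht => ht.1
  have hlt : ∀ t, 0 ≤ t → t < t₀ → γ t ∉ D := fun t h2 h3 h4 =>
    absurd (csInf_le hbdd (⟨h2, h4⟩ : t ∈ S)) (not_le.2 h3)
  have hn : γ t₀ ∉ D := by
    intro hmem
    have hpos : 0 < t₀ := by
      rcases h0.lt_or_eq with h | h
      · exact h
      · rw [← h] at hmem
        exact absurd (by simpa [hγ] using hmem) hy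
    have hnh : ∀ᶠ t in nhdsWithin t₀ (Set.Iio t₀), γ t ∈ D :=
      (hγc.continuousAt.eventually (hD.mem_nhds hmem)).filter_mono nhdsWithin_le_nhds
    obtain ⟨t, ht1, ht2⟩ := (hnh.and (Ioo_mem_nhdsLT hpos)).exists
    exact hlt t ht2.1.le ht2.2 ht1
  refine ⟨γ t₀, ?_, ?_⟩
  · refine (seg_pre y (d - y) 0 t₀).subset_connectedComponentIn ⟨0, ⟨le_rfl, h0⟩, by simp⟩ ?_
      ⟨t₀, ⟨h0, le_rfl⟩, rfl⟩
    rintro _ ⟨t, ht, rfl⟩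
    rcases ht.2.lt_or_eq with h | h
    · exact hlt t ht.1 h
    · rw [h]; exact hn
  · have hc : t₀ ∈ closure S := csInf_mem_closure ⟨1, h1⟩ hbdd
    exact map_mem_closure hγc hc fun t ht => ht.2

lemma climb {F : E2 → ℝ} (hd : Differentiable ℝ F) {p : E2} (hp : F p = 0) (hr : fderiv ℝ F p ≠ 0) :
    ∃ e : E2, ∃ δ > 0, ∀ t : ℝ, 0 < t → t ≤ δ → 0 < F (p + t • e) := by
  obtain ⟨e, he⟩ : ∃ e, 0 < fderiv ℝ F p e := by
    by_contra hn
    push Not at hn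
    apply hr
    ext v
    have h1 := hn v
    have h2 := hn (-v)
    rw [map_neg] at h2
    simp; linarith
  refine ⟨e, ?_⟩
  have hl : HasDerivAt (fun t : ℝ => p + t • e) e 0 := by
    simpa using ((hasDerivAt_id (0:ℝ)).smul_const e).const_add p
  have hg : HasDerivAt (fun t : ℝ => F (p + t • e)) (fderiv ℝ F p e) 0 := by
    have h2 := HasFDerivAt.comp_hasDerivAt_of_eq (l := F) (y := p) (0:ℝ) (hd p).hasFDerivAt hl (by simp)
    exact h2
  have hev : ∀ᶠ t in nhdsWithin (0:ℝ) (Set.Ioi 0), 0 < F (p + t • e) := by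
    have h3 := hg.tendsto_slope.mono_left (nhdsWithin_mono (0:ℝ) (fun t (ht : t ∈ Set.Ioi (0:ℝ)) => (ne_of_gt ht : t ≠ 0)))
    filter_upwards [h3.eventually (lt_mem_nhds he), self_mem_nhdsWithin] with t ht ht0
    have ht0' : 0 < t := ht0
    simp only [slope, vsub_eq_sub, sub_zero, smul_eq_mul, zero_smul, add_zero, hp] at ht
    exact (pos_iff_pos_of_mul_pos ht).1 (inv_pos.2 ht0')
  obtain ⟨δ, hδ, h⟩ := mem_nhdsGT_iff_exists_Ioc_subset.1 hev
  exact ⟨δ, hδ, fun t h1 h2 => h ⟨h1, h2⟩⟩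

/-- every complementary component of a negative nodal domain contains a positive nodal domain -/
lemma pos_in_comp {F : E2 → ℝ} (hd : Differentiable ℝ F) (hreg : ∀ x, F x = 0 → fderiv ℝ F x ≠ 0)
    {D : Set E2} (hDo : IsOpen D) (hDneg : ∀ x ∈ D, F x < 0) (hDfr : ∀ x ∈ closure D, x ∉ D → F x = 0)
    {y d : E2} (hy : y ∈ Dᶜ) (hdD : d ∈ D) :
    ∃ z, 0 < F z ∧ connectedComponentIn {x | F x ≠ 0} z ⊆ connectedComponentIn Dᶜ y := by
  obtain ⟨p, hpK, hpc⟩ := reach_closure hDo hy hdD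
  have hpD : p ∈ Dᶜ := connectedComponentIn_subset _ _ hpK
  have hFp := hDfr p hpc hpD
  obtain ⟨e, δ, hδ, h⟩ := climb hd hFp (hreg p hFp)
  have hz := h δ hδ le_rfl
  refine ⟨p + δ • e, hz, ?_⟩
  have hzK : p + δ • e ∈ connectedComponentIn Dᶜ p := by
    refine (seg_pre p e 0 δ).subset_connectedComponentIn ⟨0, ⟨le_rfl, hδ.le⟩, by simp⟩ ?_
      ⟨δ, ⟨hδ.le, le_rfl⟩, rfl⟩
    rintro _ ⟨t, ht, rfl⟩ hm
    have h1 := hDneg _ hm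
    rcases ht.1.lt_or_eq with h2 | h2
    · have := h t h2 ht.2
      simp only at h1; linarith
    · rw [← h2] at h1; simp [hFp] at h1
  rw [connectedComponentIn_eq hpK, connectedComponentIn_eq hzK]
  refine isPreconnected_connectedComponentIn.subset_connectedComponentIn
    (mem_connectedComponentIn hz.ne') ?_
  intro x hx hxD
  have := pre_sign hd.continuous isPreconnected_connectedComponentIn
      (fun z hz => connectedComponentIn_subset _ _ hz) (mem_connectedComponentIn hz.ne') hx hz
  linarith [hDneg x hxD]

lemma sphere_sign {F : E2 → ℝ} (hF : Continuous F) {ρ : ℝ} (hρ : 0 ≤ ρ)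
    (h0 : ∀ x : E2, ‖x‖ = ρ → F x ≠ 0) :
    (0 < mean F ρ → ∀ x : E2, ‖x‖ = ρ → 0 < F x) ∧ (mean F ρ < 0 → ∀ x : E2, ‖x‖ = ρ → F x < 0) := by
  have hs : IsPreconnected (sphere (0:E2) ρ) := isPreconnected_sphere rank_E2 0 ρ
  have hp : ∀ θ, ‖pol ρ θ‖ = ρ := fun θ => by rw [pol_norm, abs_of_nonneg hρ]
  constructor
  · intro hm x hx
    by_contra hn
    have hneg : F x < 0 := lt_of_le_of_ne (not_lt.1 hn) (h0 x hx)
    have : mean F ρ ≤ 0 := by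
      have h1 : 0 ≤ ∫ θ in (-Real.pi)..Real.pi, - F (pol ρ θ) :=
        intervalIntegral.integral_nonneg (by linarith [Real.pi_pos]) fun θ _ => by
          have := pre_sign_neg hF hs (fun z hz => h0 z (by simpa using hz))
            (y := x) (z := pol ρ θ) (by simpa using hx) (by simpa using hp θ) hneg
          linarith
      rw [intervalIntegral.integral_neg] at h1
      simp only [mean]; linarith
    linarith
  · intro hm x hx
    by_contra hn
    have hpos : 0 < F x := lt_of_le_of_ne (not_lt.1 hn) (Ne.symm (h0 x hx))
    have : 0 ≤ mean F ρ :=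
      intervalIntegral.integral_nonneg (by linarith [Real.pi_pos]) fun θ _ =>
        (pre_sign hF hs (fun z hz => h0 z (by simpa using hz))
            (y := x) (z := pol ρ θ) (by simpa using hx) (by simpa using hp θ) hpos).le
    linarith

lemma nodal_fr {F : E2 → ℝ} (hF : Continuous F) {x y : E2}
    (hy : y ∈ closure (connectedComponentIn {x | F x ≠ 0} x))
    (hn : y ∉ connectedComponentIn {x | F x ≠ 0} x) : F y = 0 := by
  have hop : IsOpen {x | F x ≠ 0} := isOpen_ne_fun hF continuous_const
  by_contra hFy
  obtain ⟨w, hw1, hw2⟩ := mem_closure_iff.1 hy _ (hop.connectedComponentIn (x := y))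
    (mem_connectedComponentIn hFy)
  apply hn
  rw [connectedComponentIn_eq hw2, ← connectedComponentIn_eq hw1]
  exact mem_connectedComponentIn hFy

lemma main_pos
    (M : ℕ) (hM : 2 ≤ M) (r : ℕ → ℝ)
    (hmono : ∀ k, 1 ≤ k → k < M → r k < r (k + 1))
    (hr1 : besselJZero 0 1 < r 1 ∧ r 1 < Real.sqrt 2 * besselJZero 0 1)
    (hrM : besselJZero 0 2 < r M ∧ r M < besselJZero 0 3)
    (hstep : ∀ k, 2 ≤ k → k ≤ M → r k ^ 2 - r (k - 1) ^ 2 < besselJZero 0 1 ^ 2)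
    (F : E2 → ℝ) (hF : ContDiff ℝ (⊤ : ℕ∞) F)
    (hEq : ∀ x, laplacian F x + F x = 0)
    (hF0 : 0 < F 0)
    (hreg : ∀ x, F x = 0 → fderiv ℝ F x ≠ 0)
    (hcirc : ∀ k, 1 ≤ k → k ≤ M → ∀ x : E2, ‖x‖ = r k → F x ≠ 0) :
    ∃ x₀, F x₀ ≠ 0 ∧
      connectedComponentIn {x | F x ≠ 0} x₀ ⊆ ball 0 (r M) ∧
      (componentsOf (connectedComponentIn {x | F x ≠ 0} x₀)ᶜ).ncard = 2 := by
  classical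
  have hne : ((⊤ : ℕ∞) : WithTop ℕ∞) ≠ 0 := by simp
  obtain ⟨hj2, hj6, hJneg, hJpos⟩ := bessel_facts
  have hFd := hF.differentiable hne
  have hFc := hF.continuous
  have hop : IsOpen {x | F x ≠ 0} := isOpen_ne_fun hFc continuous_const
  have hr1' : 2 < r 1 := by linarith [hr1.1]
  have rmono : ∀ i j, 1 ≤ i → i ≤ j → j ≤ M → r i ≤ r j := by
    intro i j hi hij
    induction j, hij using Nat.le_induction with
    | base => intro _; exact le_rfl
    | succ k hk ih => intro h; exact (ih (by omega)).trans (hmono k (by omega) (by omega)).le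
  have rpos : ∀ i, 1 ≤ i → i ≤ M → 2 < r i := fun i h1 h2 => hr1'.trans_le (rmono 1 i le_rfl h1 h2)
  have hpi := Real.pi_pos
  have hC1 : ∀ x : E2, ‖x‖ = r 1 → F x < 0 := by
    refine (sphere_sign hFc (by linarith) (hcirc 1 le_rfl (by omega))).2 ?_
    rw [mean_eq hF hEq (by linarith)]
    have := hJneg (r 1) hr1.1 hr1.2
    exact mul_neg_of_pos_of_neg (by positivity) this
  have hCM : ∀ x : E2, ‖x‖ = r M → 0 < F x := by
    have h2 := rmono 1 M le_rfl (by omega) le_rfl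
    refine (sphere_sign hFc (by linarith) (hcirc M (by omega) le_rfl)).1 ?_
    rw [mean_eq hF hEq (by linarith)]
    have := hJpos (r M) (by linarith [hr1.1]) hrM.1 hrM.2
    positivity
  have hpn : ∀ i, 1 ≤ i → i ≤ M → ‖pol (r i) 0‖ = r i := fun i h1 h2 => by
    rw [pol_norm, abs_of_pos (by linarith [rpos i h1 h2])]
  set p := pol (r 1) 0 with hp
  have hpnorm : ‖p‖ = r 1 := hpn 1 le_rfl (by omega)
  have hFp : F p < 0 := hC1 p hpnorm
  set D := connectedComponentIn {x | F x ≠ 0} p with hD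
  have hDo : IsOpen D := hop.connectedComponentIn
  have hDp : IsPreconnected D := isPreconnected_connectedComponentIn
  have hpD : p ∈ D := mem_connectedComponentIn hFp.ne
  have hDneg : ∀ x ∈ D, F x < 0 := fun x hx =>
    pre_sign_neg hFc hDp (fun z hz => connectedComponentIn_subset _ _ hz) hpD hx hFp
  have hDfr : ∀ x ∈ closure D, x ∉ D → F x = 0 := fun x h1 h2 => nodal_fr hFc h1 h2
  have hsp : ∀ ρ, IsPreconnected (sphere (0:E2) ρ) := fun ρ => isPreconnected_sphere rank_E2 0 ρ
  have dich : ∀ k, 1 ≤ k → k ≤ M → ∀ x : E2, ‖x‖ = r k → x ∈ D → sphere (0:E2) (r k) ⊆ D := by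
    intro k h1 h2 x hx hxD
    rw [hD, connectedComponentIn_eq hxD]
    exact (hsp (r k)).subset_connectedComponentIn (by simpa using hx)
      (fun z hz => hcirc k h1 h2 z (by simpa using hz))
  have hex : ∃ k, 1 ≤ k ∧ ¬ sphere (0:E2) (r k) ⊆ D := by
    refine ⟨M, by omega, fun h => ?_⟩
    have h1 := hDneg _ (h (show pol (r M) 0 ∈ sphere (0:E2) (r M) by
      simpa using hpn M (by omega) le_rfl))
    have h2 := hCM _ (hpn M (by omega) le_rfl)
    linarith
  set n := Nat.find hex with hn
  obtain ⟨hn1, hnD⟩ := Nat.find_spec hex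
  rw [← hn] at hn1 hnD
  have hnM : n ≤ M := by
    refine Nat.find_min' hex ⟨by omega, fun h => ?_⟩
    have h1 := hDneg _ (h (show pol (r M) 0 ∈ sphere (0:E2) (r M) by
      simpa using hpn M (by omega) le_rfl))
    have h2 := hCM _ (hpn M (by omega) le_rfl)
    linarith
  have hin : ∀ i, 1 ≤ i → i < n → ∀ x : E2, ‖x‖ = r i → x ∈ D := by
    intro i h1 h2 x hx
    have := Nat.find_min hex h2
    push Not at this
    exact this h1 (by simpa using hx)
  have hnot : ∀ x : E2, ‖x‖ = r n → x ∉ D := fun x hx hxD => hnD (dich n hn1 hnM x hx hxD)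
  have hC1D : ∀ x : E2, ‖x‖ = r 1 → x ∈ D := fun x hx => dich 1 le_rfl (by omega) p hpnorm hpD (by simpa using hx)
  have hn2 : 2 ≤ n := by
    by_contra h
    have : n = 1 := by omega
    exact hnot p (by rw [this]; exact hpnorm) hpD
  have hr1n : r 1 ≤ r n := rmono 1 n le_rfl hn1 hnM
  have hDball : ∀ x ∈ D, ‖x‖ < r n := by
    intro x hx
    by_contra h
    push Not at h
    obtain ⟨w, hw, hwn⟩ := cross hDp hpD hx (by rw [hpnorm]; exact hr1n) h
    exact hnot w hwn hw
  refine ⟨p, hFp.ne, ?_, ?_⟩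
  · intro x hx
    rw [mem_ball_zero_iff]
    exact (hDball x hx).trans_le (rmono n M hn1 hnM le_rfl)
  -- complementary components
  have h0D : (0:E2) ∈ Dᶜ := fun h => by linarith [hDneg 0 h]
  set K0 := connectedComponentIn Dᶜ (0:E2) with hK0
  have hcomp_avoid : ∀ y, ∀ z ∈ connectedComponentIn Dᶜ y, z ∉ D := fun y z hz =>
    connectedComponentIn_subset _ _ hz
  have hK0ball : ∀ x ∈ K0, ‖x‖ < r 1 := by
    intro x hx
    by_contra h
    push Not at h
    obtain ⟨w, hw, hwn⟩ := cross isPreconnected_connectedComponentIn (mem_connectedComponentIn h0D) hx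
      (by rw [norm_zero]; linarith) h
    exact hcomp_avoid _ w hw (hC1D w hwn)
  set q := pol (r n) 0 with hq
  have hqn : ‖q‖ = r n := hpn n hn1 hnM
  have hqD : q ∈ Dᶜ := hnot q hqn
  set K1 := connectedComponentIn Dᶜ q with hK1
  have hK1out : ∀ x : E2, r n ≤ ‖x‖ → x ∈ K1 := by
    intro x hx
    have hrn : 2 < r n := rpos n hn1 hnM
    have hx0 : 0 < ‖x‖ := by linarith
    have hs : (r n / ‖x‖) • x ∈ K1 := by
      refine (hsp (r n)).subset_connectedComponentIn (by simpa using hqn)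
        (fun z hz => hnot z (by simpa using hz)) ?_
      rw [mem_sphere_zero_iff_norm, norm_smul, Real.norm_of_nonneg (by positivity)]
      field_simp
    rw [hK1, connectedComponentIn_eq hs]
    have hle : r n / ‖x‖ ≤ 1 := (div_le_one hx0).2 hx
    refine (seg_pre 0 x (r n / ‖x‖) 1).subset_connectedComponentIn
      ⟨r n / ‖x‖, ⟨le_rfl, hle⟩, by simp⟩ ?_ ⟨1, ⟨hle, le_rfl⟩, by simp⟩
    rintro _ ⟨t, ht, rfl⟩ hm
    have h1 := hDball _ hm
    have ht0 : 0 ≤ t := le_trans (by positivity) ht.1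
    simp only [zero_add, norm_smul, Real.norm_of_nonneg ht0] at h1
    have h2 := (div_le_iff₀ hx0).1 ht.1
    linarith
  have hK01 : K0 ≠ K1 := by
    intro h
    have h1 : q ∈ K1 := mem_connectedComponentIn hqD
    rw [← h] at h1
    have := hK0ball q h1
    linarith
  have key : ∀ y ∈ Dᶜ, connectedComponentIn Dᶜ y = K0 ∨ connectedComponentIn Dᶜ y = K1 := by
    intro y hy
    by_contra hcon
    push Not at hcon
    obtain ⟨hc0, hc1⟩ := hcon
    set K := connectedComponentIn Dᶜ y with hK
    have hKK0 : ∀ z ∈ K, z ∉ K0 := fun z hz hz0 =>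
      hc0 ((connectedComponentIn_eq hz).trans (connectedComponentIn_eq hz0).symm)
    have hKK1 : ∀ z ∈ K, z ∉ K1 := fun z hz hz0 =>
      hc1 ((connectedComponentIn_eq hz).trans (connectedComponentIn_eq hz0).symm)
    have hKn : ∀ z ∈ K, ‖z‖ < r n := fun z hz => by
      by_contra h
      exact hKK1 z hz (hK1out z (not_lt.1 h))
    have hKi : ∀ i, 1 ≤ i → i ≤ n → ∀ z ∈ K, ‖z‖ ≠ r i := by
      intro i h1 h2 z hz hzi
      rcases h2.lt_or_eq with h | h
      · exact hcomp_avoid _ z hz (hin i h1 h z hzi)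
      · rw [h] at hzi
        exact absurd (hKn z hz) (by linarith)
    obtain ⟨z, hz, hV⟩ := pos_in_comp hFd hreg hDo hDneg hDfr hy hpD
    set V := connectedComponentIn {x | F x ≠ 0} z with hVdef
    have hzV : z ∈ V := mem_connectedComponentIn hz.ne'
    have hVp : IsPreconnected V := isPreconnected_connectedComponentIn
    by_cases hz1 : ‖z‖ < r 1
    · -- two positive domains inside the first ball
      have hVb : V ⊆ ball 0 (r 1) := by
        intro x hx
        rw [mem_ball_zero_iff]
        by_contra h
        obtain ⟨w, hw, hwn⟩ := cross hVp hzV hx hz1.le (not_lt.1 h)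
        exact hKi 1 le_rfl hn1 w (hV hw) hwn
      set V0 := connectedComponentIn {x | F x ≠ 0} (0:E2) with hV0
      have hV0K : V0 ⊆ K0 := by
        refine isPreconnected_connectedComponentIn.subset_connectedComponentIn
          (mem_connectedComponentIn hF0.ne') ?_
        intro x hx hxD
        have := pre_sign hFc isPreconnected_connectedComponentIn
          (fun z hz => connectedComponentIn_subset _ _ hz) (mem_connectedComponentIn hF0.ne') hx hF0
        linarith [hDneg x hxD]
      have hV0b : V0 ⊆ ball 0 (r 1) := fun x hx => by
        rw [mem_ball_zero_iff]; exact hK0ball x (hV0K hx)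
      refine two_domains hF hEq (posDom_nodal hFc hz hVb) (posDom_nodal hFc hF0 hV0b)
        ⟨z, hzV⟩ ⟨0, mem_connectedComponentIn hF0.ne'⟩ ?_ (by linarith) ?_
      · exact Set.disjoint_left.2 fun x h1 h2 => hKK0 x (hV h1) (hV0K h2)
      · have h1 : r 1 ^ 2 ≤ (Real.sqrt 2 * besselJZero 0 1) ^ 2 :=
          pow_le_pow_left₀ (by linarith) hr1.2.le 2
        rw [mul_pow, Real.sq_sqrt (by norm_num)] at h1
        linarith
    · -- a positive domain inside an annulus
      push Not at hz1
      have hex2 : ∃ k, 1 ≤ k ∧ ‖z‖ < r k := ⟨n, hn1, hKn z (hV hzV)⟩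
      set k := Nat.find hex2 with hk
      obtain ⟨hk1, hkz⟩ := Nat.find_spec hex2
      rw [← hk] at hk1 hkz
      have hkn : k ≤ n := Nat.find_min' hex2 ⟨hn1, hKn z (hV hzV)⟩
      have hk2 : 2 ≤ k := by
        by_contra h
        have : k = 1 := by omega
        rw [this] at hkz; linarith
      have hpre : r (k - 1) ≤ ‖z‖ := by
        have := Nat.find_min hex2 (m := k - 1) (by omega)
        push Not at this
        exact this (by omega)
      have hVb : ∀ x ∈ V, ‖x‖ < r k := by
        intro x hx
        by_contra h
        obtain ⟨w, hw, hwn⟩ := cross hVp hzV hx hkz.le (not_lt.1 h)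
        exact hKi k hk1 hkn w (hV hw) hwn
      have hVa : ∀ x ∈ V, r (k - 1) ≤ ‖x‖ := by
        intro x hx
        by_contra h
        obtain ⟨w, hw, hwn⟩ := cross hVp hx hzV (not_le.1 h).le hpre
        exact hKi (k - 1) (by omega) (by omega) w (hV hw) hwn
      have hrk := rpos (k - 1) (by omega) (by omega)
      have hst := hstep k hk2 (hkn.trans hnM)
      refine annulus hF hEq (posDom_nodal hFc hz (R := r k) fun x hx => by
        rw [mem_ball_zero_iff]; exact hVb x hx) ⟨z, hzV⟩ (a := r (k - 1) ^ 2) (b := r k ^ 2)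
        (by nlinarith) (by linarith) ?_
      intro x hx
      exact ⟨pow_le_pow_left₀ (by linarith) (hVa x hx) 2,
        pow_le_pow_left₀ (norm_nonneg _) (hVb x hx).le 2⟩
  have hset : componentsOf Dᶜ = {K0, K1} := by
    ext C
    constructor
    · rintro ⟨y, hy, rfl⟩
      exact key y hy
    · rintro (rfl | rfl)
      · exact ⟨0, h0D, rfl⟩
      · exact ⟨q, hqD, rfl⟩
  rw [hset, Set.ncard_pair hK01]

/-- If `j₀₁ < r₁ < √2 j₀₁`, `j₀₂ < r_M < j₀₃`, `r_k² - r_{k-1}² < j₀₁²` for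
`2 ≤ k ≤ M`, and `F` is an eigenfunction (`ΔF + F = 0`, `F(0) ≠ 0`, `0` a regular
value) not vanishing on any circle `|x| = r_k`, then `F` has a nodal domain of
connectivity `1` contained in the ball of radius `r_M` around the origin. -/
theorem nodal_domain_of_connectivity_one
    (M : ℕ) (hM : 2 ≤ M) (r : ℕ → ℝ)
    (hmono : ∀ k, 1 ≤ k → k < M → r k < r (k + 1))
    (hr1 : besselJZero 0 1 < r 1 ∧ r 1 < Real.sqrt 2 * besselJZero 0 1)
    (hrM : besselJZero 0 2 < r M ∧ r M < besselJZero 0 3)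
    (hstep : ∀ k, 2 ≤ k → k ≤ M → r k ^ 2 - r (k - 1) ^ 2 < besselJZero 0 1 ^ 2)
    (F : EuclideanSpace ℝ (Fin 2) → ℝ) (hF : ContDiff ℝ (⊤ : ℕ∞) F)
    (hEq : ∀ x, laplacian F x + F x = 0)
    (hF0 : F 0 ≠ 0)
    (hreg : ∀ x, F x = 0 → fderiv ℝ F x ≠ 0)
    (hcirc : ∀ k, 1 ≤ k → k ≤ M → ∀ x : EuclideanSpace ℝ (Fin 2), ‖x‖ = r k → F x ≠ 0) :
    ∃ x₀, F x₀ ≠ 0 ∧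
      connectedComponentIn {x | F x ≠ 0} x₀ ⊆ ball 0 (r M) ∧
      (componentsOf (connectedComponentIn {x | F x ≠ 0} x₀)ᶜ).ncard = 2 := by
  rcases lt_or_gt_of_ne hF0 with h | h
  · have hfd : ∀ x, fderiv ℝ (fun y => - F y) x = - fderiv ℝ F x := fun x => fderiv_fun_neg
    have hlap : ∀ x, laplacian (fun y => - F y) x = - laplacian F x := by
      intro x
      simp only [laplacian, hfd]
      rw [← Finset.sum_neg_distrib]
      refine Finset.sum_congr rfl fun i _ => ?_
      have : (fun y => (- fderiv ℝ F y) (EuclideanSpace.single i (1:ℝ))) =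
          fun y => - (fderiv ℝ F y (EuclideanSpace.single i (1:ℝ))) := rfl
      rw [this, fderiv_fun_neg]; rfl
    have := main_pos M hM r hmono hr1 hrM hstep (fun y => - F y) hF.neg
      (fun x => by rw [hlap]; linarith [hEq x]) (by linarith)
      (fun x hx => by rw [hfd]; exact neg_ne_zero.2 (hreg x (by linarith)))
      (fun k h1 h2 x hx => neg_ne_zero.2 (hcirc k h1 h2 x hx))
    simpa only [neg_ne_zero] using this
  · exact main_pos M hM r hmono hr1 hrM hstep F hF hEq h hreg hcirc
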